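/- There exists Y > 0 such that for all σ, τ in the upper half-plane with Im σ > Y and Im τ > Y, the infinite product converges absolutely and p^{-1} · ∏_{d=1}^∞ ∏_{r ∈ ℤ} (1 − p^d q^{r/2})^{C_{d mod 2, r mod 2}(rd/2)} = f̃_NS(2σ) − f̃_NS(τ). Here all factors with rd/2 < −1/2 have exponent zero, and the unique factor with a negative power of q is (1 − p q^{-1/2}), coming from (d,r) = (1,−1). -/

import Mathlib

open scoped Real

/-- The Dedekind eta function `η(τ) = e^{πiτ/12} ∏_{n=1}^∞ (1 - e^{2πinτ})`. -/
noncomputable def eta (τ : ℂ) : ℂ :=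
  Complex.exp (Real.pi * Complex.I * τ / 12) *
    ∏' n : ℕ, (1 - Complex.exp (2 * Real.pi * Complex.I * (n + 1) * τ))

/-- `f_NS(τ) = η(τ)^48/(η(τ/2)^24 η(2τ)^24) − 24`. -/
noncomputable def fNS (τ : ℂ) : ℂ :=
  eta τ ^ 48 / (eta (τ / 2) ^ 24 * eta (2 * τ) ^ 24) - 24

/-- `f̃_NS(τ) = η(τ/2)^24/η(τ)^24 + 24`. -/
noncomputable def ftNS (τ : ℂ) : ℂ :=
  eta (τ / 2) ^ 24 / eta τ ^ 24 + 24

/-- `f_R(τ) = 2^12 η(2τ)^24/η(τ)^24 + 24`. -/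
noncomputable def fR (τ : ℂ) : ℂ :=
  2 ^ 12 * eta (2 * τ) ^ 24 / eta τ ^ 24 + 24

/-- The vector-valued function with components `F_{0,0} = (f_NS − f̃_NS)/2`,
    `F_{0,1} = −(f_R + 24)/2`, `F_{1,0} = −F_{0,0}`, `F_{1,1} = (f_NS + f̃_NS)/2`. -/
noncomputable def Fcomp (i j : ZMod 2) (τ : ℂ) : ℂ :=
  if i = 0 then (if j = 0 then (fNS τ - ftNS τ) / 2 else -(fR τ + 24) / 2)
  else (if j = 0 then (ftNS τ - fNS τ) / 2 else (fNS τ + ftNS τ) / 2)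

section
open scoped Real
open Filter Topology

/-- the cusp filter -/
noncomputable def cuspF : Filter ℂ := comap Complex.im atTop

lemma im_neg_inv {z : ℂ} (hz : 0 < z.im) : 0 < (-1 / z).im := by
  have : 0 < Complex.normSq z := Complex.normSq_pos.2 (by rintro rfl; simp at hz)
  rw [Complex.div_im]
  simp only [Complex.neg_im, Complex.one_im, Complex.neg_re, Complex.one_re]
  have h2 : 0 < z.im / Complex.normSq z := div_pos hz this
  ring_nf at h2 ⊢
  exact h2

open UpperHalfPlane ModularGroup MatrixGroups ModularForm SlashInvariantForm in
lemma key_zero (g : ℂ → ℂ) (hd : DifferentiableOn ℂ g {z | 0 < z.im})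
    (hT : ∀ z : ℂ, 0 < z.im → g (z + 1) = g z)
    (hS : ∀ z : ℂ, 0 < z.im → g (-1 / z) = g z)
    (hlim : Tendsto g cuspF (𝓝 0)) : ∀ z : ℂ, 0 < z.im → g z = 0 := by
  let G : ℍ → ℂ := fun z => g z
  have hGS : G ∣[(0 : ℤ)] S = G := by
    ext z
    rw [ModularForm.SL_slash_apply, UpperHalfPlane.modular_S_smul]
    have := hS z z.2
    simp only [neg_zero, zpow_zero, mul_one, G]
    rw [← this]
    congr 1
    simp [neg_div, inv_neg]
  have hGT : G ∣[(0 : ℤ)] T = G := by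
    ext z
    rw [ModularForm.SL_slash_apply, UpperHalfPlane.modular_T_smul]
    have := hT z z.2
    simp only [neg_zero, zpow_zero, mul_one, G]
    rw [← this]
    congr 1
    simp [add_comm]
  have hG0 : Tendsto G atImInfty (𝓝 0) := by
    refine hlim.comp ?_
    rw [cuspF, tendsto_comap_iff]
    exact tendsto_comap
  let F : ModularForm 𝒮ℒ 0 :=
    { toFun := G
      slash_action_eq' := by
        intro A hA
        obtain ⟨A, rfl⟩ := hA
        exact slash_action_generators_SL2Z hGS hGT A
      holo' := by
        rw [UpperHalfPlane.mdifferentiable_iff]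
        refine hd.congr fun z hz ↦ ?_
        simp [G, ofComplex_apply_of_im_pos hz]
      bdd_at_cusps' := by
        intro c hc
        rw [Subgroup.IsArithmetic.isCusp_iff_isCusp_SL2Z] at hc
        rw [OnePoint.isBoundedAt_iff_forall_SL2Z hc]
        intro γ _
        rw [slash_action_generators_SL2Z hGS hGT]
        exact hG0.isBigO_one ℝ }
  obtain ⟨c, hc⟩ := ModularFormClass.levelOne_weight_zero_const F
  have hGc : ∀ z, G z = c := fun z => congrFun hc z
  have : c = 0 := by
    have h2 : Tendsto G atImInfty (𝓝 c) := by
      rw [show G = fun _ => c from funext hGc]; exact tendsto_const_nhds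
    exact tendsto_nhds_unique h2 hG0
  intro z hz
  have := hGc ⟨z, hz⟩
  simp [G, *] at this ⊢

lemma key_prod (D1 D2 D3 : ℂ → ℂ) (hd1 : DifferentiableOn ℂ D1 {z | 0 < z.im})
    (hd2 : DifferentiableOn ℂ D2 {z | 0 < z.im}) (hd3 : DifferentiableOn ℂ D3 {z | 0 < z.im})
    (h1T : ∀ z : ℂ, 0 < z.im → D1 (z + 1) = D1 z)
    (h2T : ∀ z : ℂ, 0 < z.im → D2 (z + 1) = D3 z)
    (h3T : ∀ z : ℂ, 0 < z.im → D3 (z + 1) = D2 z)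
    (h1S : ∀ z : ℂ, 0 < z.im → D1 (-1 / z) = D2 z)
    (h2S : ∀ z : ℂ, 0 < z.im → D2 (-1 / z) = D1 z)
    (h3S : ∀ z : ℂ, 0 < z.im → D3 (-1 / z) = D3 z)
    (hl1 : Tendsto D1 cuspF (𝓝 0))
    (hl2 : D2 =O[cuspF] (fun _ => (1 : ℝ))) (hl3 : D3 =O[cuspF] (fun _ => (1 : ℝ))) :
    ∀ z : ℂ, 0 < z.im → D1 z = 0 := by
  have hz : ∀ z : ℂ, 0 < z.im → (fun z => D1 z * (D2 z * D3 z)) z = 0 := by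
    apply key_zero
    · exact hd1.mul (hd2.mul hd3)
    · intro z hz; simp only [h1T z hz, h2T z hz, h3T z hz]; ring
    · intro z hz; simp only [h1S z hz, h2S z hz, h3S z hz]; ring
    · have h1 : D1 =o[cuspF] (fun _ => (1 : ℝ)) := (Asymptotics.isLittleO_one_iff ℝ).2 hl1
      have := h1.mul_isBigO (hl2.mul hl3)
      simpa using (Asymptotics.isLittleO_one_iff ℝ).1 (by simpa using this)
  have hopen : IsOpen {z : ℂ | 0 < z.im} := isOpen_lt continuous_const Complex.continuous_im
  have hconn : IsPreconnected {z : ℂ | 0 < z.im} :=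
    (convex_halfSpace_im_gt 0).isPreconnected
  have han : ∀ D : ℂ → ℂ, DifferentiableOn ℂ D {z | 0 < z.im} →
      AnalyticOnNhd ℂ D {z | 0 < z.im} := fun D h => h.analyticOnNhd hopen
  have hD : (∀ z : ℂ, 0 < z.im → D1 z = 0) ∨ (∀ z : ℂ, 0 < z.im → (fun z => D2 z * D3 z) z = 0) := by
    have := AnalyticOnNhd.eq_zero_or_eq_zero_of_mul_eq_zero (han D1 hd1) (han _ (hd2.mul hd3)) hz hconn
    exact this
  rcases hD with h | h
  · exact h
  have hD : (∀ z : ℂ, 0 < z.im → D2 z = 0) ∨ (∀ z : ℂ, 0 < z.im → D3 z = 0) := by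
    have := AnalyticOnNhd.eq_zero_or_eq_zero_of_mul_eq_zero (han D2 hd2) (han D3 hd3) h hconn
    exact this
  have h2 : ∀ z : ℂ, 0 < z.im → D2 z = 0 := by
    rcases hD with h | h
    · exact h
    · intro z hz
      rw [← h3T z hz]; exact h _ (by simpa using hz)
  intro z hz
  rw [← h2S z hz]
  apply h2
  exact im_neg_inv hz
end

section
open scoped Real
open Filter Topology

noncomputable def ee (z : ℂ) : ℂ := Complex.exp (2 * π * Complex.I * z)
noncomputable def tF (z : ℂ) : ℂ := eta z ^ 24 / eta (2 * z) ^ 24 + 24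
noncomputable def sF (z : ℂ) : ℂ := eta (2 * z) ^ 24 / eta z ^ 24
noncomputable def GF (q : ℂ) : ℂ := (∏' j : ℕ, (1 - q ^ (2 * j + 1))) ^ 24

lemma ee_add (z w : ℂ) : ee (z + w) = ee z * ee w := by
  simp [ee, mul_add, Complex.exp_add]
lemma ee_ne (z : ℂ) : ee z ≠ 0 := Complex.exp_ne_zero _
lemma ee_int (n : ℤ) : ee n = 1 := by
  rw [ee, Complex.exp_eq_one_iff]; exact ⟨n, by ring⟩
lemma ee_one : ee 1 = 1 := by simpa using ee_int 1
lemma ee_norm (z : ℂ) : ‖ee z‖ = Real.exp (-(2 * π * z.im)) := by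
  rw [ee, Complex.norm_exp]; simp
lemma ee_norm_lt {z : ℂ} (hz : 0 < z.im) : ‖ee z‖ < 1 := by
  rw [ee_norm, Real.exp_lt_one_iff]; have := Real.pi_pos; simp; positivity
lemma ee_pow (z : ℂ) (n : ℕ) : ee z ^ n = ee (n * z) := by
  rw [ee, ← Complex.exp_nat_mul, ee]; ring_nf
lemma ee_zpow (z : ℂ) (n : ℤ) : ee z ^ n = ee (n * z) := by
  rw [ee, ← Complex.exp_int_mul, ee]; ring_nf
lemma ee_neg (z : ℂ) : ee (-z) = (ee z)⁻¹ := by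
  rw [ee, ee, ← Complex.exp_neg]; ring_nf
lemma ee_diff : Differentiable ℂ ee := by unfold ee; fun_prop

lemma ee_tendsto : Tendsto ee cuspF (𝓝 0) := by
  rw [tendsto_zero_iff_norm_tendsto_zero]
  have h : Tendsto (fun z : ℂ => z.im) cuspF atTop := tendsto_comap
  simp_rw [ee_norm]
  apply Real.tendsto_exp_neg_atTop_nhds_zero.comp
  exact h.const_mul_atTop (by have := Real.pi_pos; positivity)

lemma eta_eq (z : ℂ) : eta z = ModularForm.eta z := by
  rw [eta, ModularForm.eta]
  simp_rw [ModularForm.eta_q_eq_cexp]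
  congr 1
  rw [Function.Periodic.qParam]; congr 1; push_cast; ring

lemma eta_ne {z : ℂ} (hz : 0 < z.im) : eta z ≠ 0 := by
  rw [eta_eq]; exact ModularForm.eta_ne_zero hz

lemma eta_prod (z : ℂ) : eta z ^ 24 = ee z * (∏' n : ℕ, (1 - ee z ^ (n + 1))) ^ 24 := by
  have h1 : Complex.exp (Real.pi * Complex.I * z / 12) ^ 24 = ee z := by
    rw [← Complex.exp_nat_mul, ee]; congr 1; push_cast; ring
  have h2 : ∀ n : ℕ, Complex.exp (2 * Real.pi * Complex.I * (n + 1) * z) = ee z ^ (n + 1) := by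
    intro n; rw [ee_pow, ee]; congr 1; push_cast; ring
  rw [eta, mul_pow, h1]
  simp_rw [h2]

lemma eta_T (z : ℂ) : eta (z + 1) ^ 24 = eta z ^ 24 := by
  rw [eta_prod, eta_prod, ee_add, ee_one, mul_one]

lemma csq24 {z : ℂ} (hz : z ≠ 0) : Complex.sqrt z ^ 24 = z ^ 12 := by
  rw [_root_.sqrt_eq_exp hz, ← Complex.exp_nat_mul]
  ring_nf
  rw [show (Complex.log z * 12) = (12 : ℕ) * Complex.log z by push_cast; ring, Complex.exp_nat_mul,
    Complex.exp_log hz]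

lemma csqI24 : Complex.sqrt Complex.I ^ 24 = 1 := by
  rw [csq24 Complex.I_ne_zero, show 12 = 4 * 3 by lia, pow_mul, Complex.I_pow_four, one_pow]

lemma eta_S {z : ℂ} (hz : 0 < z.im) : eta (-1 / z) ^ 24 = z ^ 12 * eta z ^ 24 := by
  have hz0 : z ≠ 0 := by rintro rfl; simp at hz
  have he : ModularForm.eta (-1 / z) = (Complex.sqrt Complex.I)⁻¹ * (Complex.sqrt z * ModularForm.eta z) := by
    simpa [neg_div] using ModularForm.eta_comp_eq_csqrt_I_inv (x := z) hz
  rw [eta_eq, eta_eq, he]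
  simp only [mul_pow, inv_pow, csqI24, csq24 hz0]
  simp

lemma eta_diff : DifferentiableOn ℂ eta {z | 0 < z.im} := by
  intro z hz
  rw [show eta = ModularForm.eta from funext eta_eq]
  exact (ModularForm.differentiableAt_eta_of_mem_upperHalfPlaneSet hz).differentiableWithinAt

lemma eta_diff_at {z : ℂ} (hz : 0 < z.im) : DifferentiableAt ℂ eta z := by
  rw [show eta = ModularForm.eta from funext eta_eq]
  exact ModularForm.differentiableAt_eta_of_mem_upperHalfPlaneSet hz

lemma im_two {z : ℂ} (hz : 0 < z.im) : 0 < (2 * z).im := by simp; exact hz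

lemma tF_diff {z : ℂ} (hz : 0 < z.im) : DifferentiableAt ℂ tF z := by
  have h1 := eta_diff_at hz
  have h2 : DifferentiableAt ℂ (fun z => eta (2 * z)) z :=
    DifferentiableAt.comp (f := fun z => 2 * z) (g := eta) z (eta_diff_at (im_two hz)) (by fun_prop)
  unfold tF
  exact ((h1.pow 24).div (h2.pow 24) (pow_ne_zero _ (eta_ne (im_two hz)))).add_const _

lemma sF_eq {z : ℂ} (hz : 0 < z.im) : (tF z - 24) * sF z = 1 := by
  have := eta_ne hz
  have := eta_ne (im_two hz)
  unfold tF sF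
  field_simp
  simp

lemma sF_diff {z : ℂ} (hz : 0 < z.im) : DifferentiableAt ℂ sF z := by
  have h1 := eta_diff_at hz
  have h2 : DifferentiableAt ℂ (fun z => eta (2 * z)) z :=
    DifferentiableAt.comp (f := fun z => 2 * z) (g := eta) z (eta_diff_at (im_two hz)) (by fun_prop)
  unfold sF
  exact ((h2.pow 24).div (h1.pow 24) (pow_ne_zero _ (eta_ne hz)))

lemma tF_T (z : ℂ) : tF (z + 1) = tF z := by
  unfold tF
  rw [eta_T, show 2 * (z + 1) = 2 * z + 1 + 1 by ring, eta_T, eta_T]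
lemma sF_T (z : ℂ) : sF (z + 1) = sF z := by
  unfold sF
  rw [eta_T, show 2 * (z + 1) = 2 * z + 1 + 1 by ring, eta_T, eta_T]

lemma tF_S {z : ℂ} (hz : 0 < z.im) : tF (-1 / z) = 24 + 4096 * sF (z / 2) := by
  have hz0 : z ≠ 0 := by rintro rfl; simp at hz
  have h2 : 0 < (z / 2).im := by simp; exact hz
  have := eta_ne h2
  unfold tF sF
  rw [show 2 * (-1 / z) = -1 / (z / 2) by field_simp, eta_S hz, eta_S h2,
    show 2 * (z / 2) = z by ring]
  field_simp
  ring

lemma sF_S {z : ℂ} (hz : 0 < z.im) : 4096 * sF (-1 / z) = tF (z / 2) - 24 := by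
  have hz0 : z ≠ 0 := by rintro rfl; simp at hz
  have h2 : 0 < (z / 2).im := by simp; exact hz
  have := eta_ne h2
  have := eta_ne hz
  unfold tF sF
  rw [show 2 * (-1 / z) = -1 / (z / 2) by field_simp, eta_S hz, eta_S h2,
    show 2 * (z / 2) = z by ring]
  field_simp
  ring

lemma summ_odd {q : ℂ} (hq : ‖q‖ < 1) (k : ℕ) : Summable fun j : ℕ => ‖-q ^ (2 * j + k)‖ := by
  have h : Summable fun j : ℕ => ‖q‖ ^ j := summable_geometric_of_lt_one (norm_nonneg _) hq
  refine h.of_nonneg_of_le (fun _ => norm_nonneg _) fun j => ?_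
  rw [norm_neg, norm_pow]
  exact pow_le_pow_of_le_one (norm_nonneg _) hq.le (by omega)

lemma mult_odd {q : ℂ} (hq : ‖q‖ < 1) (k : ℕ) : Multipliable fun j : ℕ => 1 - q ^ (2 * j + k) := by
  have := multipliable_one_add_of_summable (summ_odd hq k)
  simpa [sub_eq_add_neg] using this

lemma tF_GF {z : ℂ} (hz : 0 < z.im) : tF z = GF (ee z) / ee z + 24 := by
  have hq := ee_norm_lt hz
  have h : ∏' n : ℕ, (1 - ee z ^ (n + 1)) =
      (∏' j : ℕ, (1 - ee z ^ (2 * j + 1))) * ∏' n : ℕ, (1 - ee (2 * z) ^ (n + 1)) := by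
    rw [← tprod_even_mul_odd (f := fun n : ℕ => (1 - ee z ^ (n + 1)))]
    · congr 2; ext j
      rw [show ee (2 * z) = ee z ^ 2 by rw [ee_pow]; norm_num, ← pow_mul]
      ring_nf
    · exact mult_odd hq 1
    · exact mult_odd hq 2
  unfold tF GF
  have h1 := eta_ne (im_two hz)
  have h2 : (∏' n : ℕ, (1 - ee (2 * z) ^ (n + 1))) ^ 24 ≠ 0 := by
    intro h0
    have := eta_prod (2 * z)
    rw [h0, mul_zero] at this
    exact pow_ne_zero _ h1 this
  have h3 : ee (2 * z) = ee z ^ 2 := by rw [ee_pow]; norm_num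
  rw [eta_prod, eta_prod, h, mul_pow]
  have := ee_ne z
  have := ee_ne (2 * z)
  rw [add_left_inj]
  rw [div_eq_div_iff (mul_ne_zero (ee_ne _) h2) (ee_ne _)]
  rw [h3]; ring

lemma GF_bound {q : ℂ} (hq : ‖q‖ < 1) : ‖GF q‖ ≤ Real.exp (24 / (1 - ‖q‖)) := by
  have h : ‖∏' j : ℕ, (1 - q ^ (2 * j + 1))‖ ≤ Real.exp (1 / (1 - ‖q‖)) := by
    have hp := (mult_odd hq 1).hasProd.norm
    refine le_of_tendsto hp (Eventually.of_forall fun s => ?_)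
    calc ∏ j ∈ s, ‖1 - q ^ (2 * j + 1)‖ ≤ ∏ j ∈ s, Real.exp (‖q‖ ^ j) := by
          apply Finset.prod_le_prod (fun _ _ => norm_nonneg _)
          intro j _
          calc ‖1 - q ^ (2 * j + 1)‖ ≤ 1 + ‖q‖ ^ (2 * j + 1) := by
                refine (norm_sub_le _ _).trans ?_; simp
            _ ≤ ‖q‖ ^ j + 1 := by
                have : ‖q‖ ^ (2 * j + 1) ≤ ‖q‖ ^ j :=
                  pow_le_pow_of_le_one (norm_nonneg _) hq.le (by omega)
                linarith
            _ ≤ _ := Real.add_one_le_exp _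
      _ = Real.exp (∑ j ∈ s, ‖q‖ ^ j) := by rw [Real.exp_sum]
      _ ≤ _ := by
          apply Real.exp_le_exp.2
          rw [one_div, ← tsum_geometric_of_lt_one (norm_nonneg _) hq]
          exact (summable_geometric_of_lt_one (norm_nonneg _) hq).sum_le_tsum _ (fun _ _ => by positivity)
  unfold GF
  rw [norm_pow]
  calc _ ≤ Real.exp (1 / (1 - ‖q‖)) ^ 24 := by gcongr
    _ = _ := by rw [← Real.exp_nat_mul]; congr 1; push_cast; ring

lemma odd_tend (k : ℕ) : Tendsto (fun q : ℂ => ∏' j : ℕ, (1 - q ^ (2 * j + (k + 1)))) (𝓝 0) (𝓝 1) := by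
  have := tendsto_tprod_one_add_of_dominated_convergence (𝓕 := 𝓝 0) (g := 0)
      (f := fun (q : ℂ) (n : ℕ) ↦ -q ^ (2 * n + (k + 1))) (bound := fun n ↦ (1 / 2 : ℝ) ^ n)
  simp only [Pi.zero_apply, norm_neg, norm_pow, add_zero, tprod_one] at this
  simp_rw [sub_eq_add_neg]
  refine this (summable_geometric_of_abs_lt_one (by norm_num [abs_of_pos]))
      (fun n ↦ by
        have := ((continuous_pow (M := ℂ) (2 * n + (k + 1))).tendsto 0).neg
        simpa using this) ?_
  filter_upwards [Metric.ball_mem_nhds (0 : ℂ) (by norm_num : (0 : ℝ) < 1 / 2)] with q hq n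
  have hq : ‖q‖ < 1 / 2 := mem_ball_zero_iff.mp hq
  calc ‖q‖ ^ (2 * n + (k + 1)) ≤ ‖q‖ ^ n :=
        pow_le_pow_of_le_one (norm_nonneg _) (by linarith) (by omega)
    _ ≤ _ := by gcongr

lemma odd_split {q : ℂ} (hq : ‖q‖ < 1) : ∏' j : ℕ, (1 - q ^ (2 * j + 1)) =
    (1 - q) * ∏' j : ℕ, (1 - q ^ (2 * j + 3)) := by
  rw [tprod_eq_zero_mul' (f := fun j : ℕ => (1 - q ^ (2 * j + 1)))]
  · simp [mul_add, add_assoc]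
  · exact (mult_odd hq 3).congr (fun j => by ring_nf)

lemma tprod_sub_one {f : ℕ → ℂ} (hf : Summable fun j => ‖f j‖) :
    ‖∏' j, (1 + f j) - 1‖ ≤ Real.exp (∑' j, ‖f j‖) - 1 := by
  have hp : HasProd (fun j => 1 + f j) (∏' j, (1 + f j)) :=
    (multipliable_one_add_of_summable hf).hasProd
  have h2 : Tendsto (fun s : Finset ℕ => ‖∏ j ∈ s, (1 + f j) - 1‖) atTop
      (𝓝 ‖∏' j, (1 + f j) - 1‖) := (Tendsto.sub_const hp 1).norm
  refine le_of_tendsto h2 (Eventually.of_forall fun s => ?_)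
  refine (s.norm_prod_one_add_sub_one_le f).trans ?_
  gcongr
  exact hf.sum_le_tsum _ (fun _ _ => norm_nonneg _)

lemma R_deriv : HasDerivAt (fun q : ℂ => ∏' j : ℕ, (1 - q ^ (2 * j + 3))) 0 0 := by
  have hv : ∏' j : ℕ, (1 - (0:ℂ) ^ (2 * j + 3)) = 1 := by simp
  rw [hasDerivAt_iff_isLittleO, hv]
  simp only [smul_zero, sub_zero]
  have h1 : (fun q : ℂ => ∏' j : ℕ, (1 - q ^ (2 * j + 3)) - 1) =O[𝓝 0] (fun q : ℂ => q ^ 2) := by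
    refine Asymptotics.IsBigO.of_bound 4 ?_
    filter_upwards [Metric.ball_mem_nhds (0 : ℂ) (by norm_num : (0 : ℝ) < 1 / 2)] with q hq
    have hq : ‖q‖ < 1 / 2 := mem_ball_zero_iff.mp hq
    have hs := summ_odd (q := q) (by linarith) 3
    have h := tprod_sub_one hs
    simp_rw [← sub_eq_add_neg] at h
    have hle : ∑' j : ℕ, ‖-q ^ (2 * j + 3)‖ ≤ 2 * ‖q‖ ^ 2 := by
      have hg : Summable fun j : ℕ => ‖q‖ ^ 2 * ‖q‖ ^ j :=
        (summable_geometric_of_lt_one (norm_nonneg _) (by linarith)).mul_left _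
      calc _ ≤ ∑' j : ℕ, ‖q‖ ^ 2 * ‖q‖ ^ j := by
            apply hs.tsum_le_tsum _ hg
            intro j
            rw [norm_neg, norm_pow, ← pow_add]
            exact pow_le_pow_of_le_one (norm_nonneg _) (by linarith) (by omega)
        _ = ‖q‖ ^ 2 * (1 - ‖q‖)⁻¹ := by
            rw [tsum_mul_left, tsum_geometric_of_lt_one (norm_nonneg _) (by linarith)]
        _ ≤ ‖q‖ ^ 2 * 2 := by
            gcongr
            rw [inv_le_comm₀ (by linarith) (by norm_num)]
            linarith
        _ = _ := by ring
    have hx : ∑' j : ℕ, ‖-q ^ (2 * j + 3)‖ ≤ 1 := by nlinarith [norm_nonneg q]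
    have h0 : 0 ≤ ∑' j : ℕ, ‖-q ^ (2 * j + 3)‖ := tsum_nonneg fun _ => norm_nonneg _
    have := Real.abs_exp_sub_one_le (x := ∑' j : ℕ, ‖-q ^ (2 * j + 3)‖) (by rwa [abs_of_nonneg h0])
    rw [abs_of_nonneg h0] at this
    have h3 := (le_abs_self _).trans this
    rw [norm_pow]
    linarith
  refine h1.trans_isLittleO ?_
  simpa using (Asymptotics.isLittleO_pow_id (𝕜 := ℂ) (n := 2) (by norm_num))

lemma GF_zero : GF 0 = 1 := by simp [GF]

lemma pow24_deriv {f : ℂ → ℂ} (hf : HasDerivAt f (-1) 0) (h0 : f 0 = 1) :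
    HasDerivAt (fun q => f q ^ 24) (-24) 0 := by
  have := hf.fun_pow 24
  rw [h0] at this
  simpa using this

lemma mul_deriv_aux {f : ℂ → ℂ} (hf : HasDerivAt f 0 0) (h0 : f 0 = 1) :
    HasDerivAt (fun q => (1 - q) * f q) (-1) 0 := by
  have := ((hasDerivAt_id' (0:ℂ)).const_sub 1).fun_mul hf
  rw [h0] at this
  simpa using this

lemma GF_deriv : HasDerivAt GF (-24) 0 := by
  have h : GF =ᶠ[𝓝 0] fun q => ((1 - q) * ∏' j : ℕ, (1 - q ^ (2 * j + 3))) ^ 24 := by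
    filter_upwards [Metric.ball_mem_nhds (0 : ℂ) (by norm_num : (0 : ℝ) < 1)] with q hq
    rw [GF, odd_split (mem_ball_zero_iff.mp hq)]
  refine HasDerivAt.congr_of_eventuallyEq ?_ h
  exact pow24_deriv (mul_deriv_aux R_deriv (by simp)) (by simp)

lemma ee_tendsto' : Tendsto ee cuspF (𝓝[≠] 0) := by
  rw [tendsto_nhdsWithin_iff]
  exact ⟨ee_tendsto, Eventually.of_forall fun z => ee_ne z⟩

lemma cuspF_pos (A : ℝ) : ∀ᶠ z : ℂ in cuspF, A < z.im :=
  (tendsto_comap (f := Complex.im) (x := atTop)).eventually (eventually_gt_atTop A)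

instance : cuspF.NeBot := by
  unfold cuspF
  apply comap_neBot
  intro t ht
  obtain ⟨a, ha⟩ := (mem_atTop_sets.1 ht)
  exact ⟨⟨0, a⟩, ha a le_rfl⟩

lemma tF_lim : Tendsto (fun z => tF z - ee (-z)) cuspF (𝓝 0) := by
  have h := (hasDerivAt_iff_tendsto_slope_zero.1 GF_deriv).comp ee_tendsto'
  have h2 := h.add_const 24
  rw [neg_add_cancel] at h2
  refine h2.congr' ?_
  filter_upwards [cuspF_pos 0] with z hz
  have := ee_ne z
  simp only [Function.comp, zero_add, smul_eq_mul, GF_zero]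
  rw [tF_GF hz, ee_neg]
  field_simp
  ring

lemma sF_lim : Tendsto sF cuspF (𝓝 0) := by
  have h1 : Tendsto (fun z => ee z / GF (ee z)) cuspF (𝓝 (0 / 1)) := by
    refine ee_tendsto.div ?_ one_ne_zero
    have := GF_deriv.continuousAt.tendsto
    rw [GF_zero] at this
    exact this.comp ee_tendsto
  rw [zero_div] at h1
  refine h1.congr' ?_
  filter_upwards [cuspF_pos 0] with z hz
  have h := sF_eq hz
  rw [tF_GF hz] at h
  have h0 := ee_ne z
  have hG : GF (ee z) ≠ 0 := by
    intro h1; rw [h1] at h; simp at h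
  field_simp at h ⊢
  linear_combination -h
end

section
open scoped Real
open Filter Topology

noncomputable def f10 (z : ℂ) : ℂ := 24 + 4096 * sF (z / 2)
noncomputable def f11 (z : ℂ) : ℂ := f10 (z + 1)
noncomputable def f00 (z : ℂ) : ℂ := tF z + f10 z + f11 z - 48

lemma im_half {z : ℂ} (hz : 0 < z.im) : 0 < (z / 2).im := by simp; exact hz
lemma im_add_one {z : ℂ} (hz : 0 < z.im) : 0 < (z + 1).im := by simpa using hz
lemma im_sub_one {z : ℂ} (hz : 0 < z.im) : 0 < (z - 1).im := by simpa using hz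

lemma f10_T2 (z : ℂ) : f10 (z + 1 + 1) = f10 z := by
  unfold f10; rw [show (z + 1 + 1) / 2 = z / 2 + 1 by ring, sF_T]
lemma f11_T (z : ℂ) : f11 (z + 1) = f10 z := f10_T2 z
lemma f00_T (z : ℂ) : f00 (z + 1) = f00 z := by
  unfold f00; rw [tF_T, f11_T]; unfold f11; ring
lemma tF_S' {z : ℂ} (hz : 0 < z.im) : tF (-1 / z) = f10 z := tF_S hz
lemma f10_S {z : ℂ} (hz : 0 < z.im) : f10 (-1 / z) = tF z := by
  have h := sF_S (im_two hz)
  have hz0 : z ≠ 0 := by rintro rfl; simp at hz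
  unfold f10
  rw [show -1 / z / 2 = -1 / (2 * z) by field_simp, h]; ring_nf
lemma f11_S {z : ℂ} (hz : 0 < z.im) : f11 (-1 / z) = f11 z := by
  have hz0 : z ≠ 0 := by rintro rfl; simp at hz
  have h1 := im_sub_one hz
  have hz1 : z - 1 ≠ 0 := by intro h; rw [h] at h1; simp at h1
  have h2 := im_add_one (im_neg_inv hz)
  unfold f11
  rw [← tF_S' h2, show -1 / (-1 / z + 1) = -1 / (z - 1) - 1 by
    have : -1 / z + 1 = (z - 1) / z := by field_simp; ring
    rw [this]; field_simp; ring, ← tF_T, sub_add_cancel, tF_S' h1, ← f10_T2]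
  ring_nf
lemma f00_S {z : ℂ} (hz : 0 < z.im) : f00 (-1 / z) = f00 z := by
  unfold f00; rw [tF_S' hz, f10_S hz, f11_S hz]; ring

lemma f10_diff {z : ℂ} (hz : 0 < z.im) : DifferentiableAt ℂ f10 z := by
  have : DifferentiableAt ℂ (fun z => sF (z / 2)) z :=
    DifferentiableAt.comp (f := fun z => z / 2) (g := sF) z (sF_diff (im_half hz)) (by fun_prop)
  unfold f10; fun_prop
lemma f11_diff {z : ℂ} (hz : 0 < z.im) : DifferentiableAt ℂ f11 z :=
  DifferentiableAt.comp (f := fun z => z + 1) (g := f10) z (f10_diff (im_add_one hz)) (by fun_prop)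
lemma f00_diff {z : ℂ} (hz : 0 < z.im) : DifferentiableAt ℂ f00 z := by
  have h1 := tF_diff hz
  have h2 := f10_diff hz
  have h3 := f11_diff hz
  exact ((h1.add h2).add h3).sub_const _

lemma cusp_aff (r : ℝ) (hr : 0 < r) (b : ℂ) : Tendsto (fun z : ℂ => r * z + b) cuspF cuspF := by
  unfold cuspF
  rw [tendsto_comap_iff]
  have h : Tendsto (fun z : ℂ => r * z.im + b.im) (comap Complex.im atTop) atTop :=
    tendsto_atTop_add_const_right _ _ (tendsto_comap.const_mul_atTop hr)
  refine h.congr fun z => by simp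

lemma cusp_half : Tendsto (fun z : ℂ => z / 2) cuspF cuspF := by
  refine (cusp_aff (1/2) (by norm_num) 0).congr fun z => by push_cast; ring
lemma cusp_half' : Tendsto (fun z : ℂ => (z + 1) / 2) cuspF cuspF := by
  refine (cusp_aff (1/2) (by norm_num) (1/2)).congr fun z => by push_cast; ring
lemma cusp_one : Tendsto (fun z : ℂ => z + 1) cuspF cuspF := by
  refine (cusp_aff (1) (by norm_num) (1)).congr fun z => by push_cast; ring

lemma f10_lim : Tendsto f10 cuspF (𝓝 24) := by
  have := ((sF_lim.comp cusp_half).const_mul 4096).const_add 24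
  rw [mul_zero, add_zero] at this
  exact this
lemma f11_lim : Tendsto f11 cuspF (𝓝 24) := f10_lim.comp cusp_one
lemma f00_lim : Tendsto (fun z => f00 z - ee (-z)) cuspF (𝓝 0) := by
  have := ((tF_lim.add f10_lim).add f11_lim).sub_const 48
  have h2 := this.congr (f₂ := fun z => f00 z - ee (-z)) fun z => by unfold f00; ring
  convert h2 using 2; norm_num

lemma U2 {w : ℂ} (hw : 0 < w.im) : tF (w / 2) + tF ((w + 1) / 2) + 4096 * sF w = 0 := by
  refine key_zero (fun w => tF (w / 2) + tF ((w + 1) / 2) + 4096 * sF w) ?_ ?_ ?_ ?_ w hw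
  · intro z hz
    have hz : 0 < z.im := hz
    have h1 : DifferentiableAt ℂ (fun z => tF (z / 2)) z :=
      DifferentiableAt.comp (f := fun z => z / 2) (g := tF) z (tF_diff (im_half hz)) (by fun_prop)
    have h2 : DifferentiableAt ℂ (fun z => tF ((z + 1) / 2)) z :=
      DifferentiableAt.comp (f := fun z => (z + 1) / 2) (g := tF) z
        (tF_diff (im_half (im_add_one hz))) (by fun_prop)
    have h3 := sF_diff hz
    exact ((h1.add h2).add (h3.const_mul 4096)).differentiableWithinAt
  · intro z hz
    rw [show (z + 1 + 1) / 2 = z / 2 + 1 by ring, tF_T, sF_T]; ring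
  · intro z hz
    have hz0 : z ≠ 0 := by rintro rfl; simp at hz
    have h1 := im_sub_one hz
    have hz1 : z - 1 ≠ 0 := by intro h; rw [h] at h1; simp at h1
    have h2 := im_add_one (im_neg_inv hz)
    have e1 : tF (-1 / z / 2) = 24 + 4096 * sF z := by
      rw [show -1 / z / 2 = -1 / (2 * z) by field_simp, tF_S (im_two hz)]; ring_nf
    have e3 : tF ((-1 / z + 1) / 2) = tF ((z + 1) / 2) := by
      have h5 : (-1 / z + 1) / 2 = -1 / (2 * (-1 / (z - 1) - 1)) := by
        have a1 : -1 / z + 1 = (z - 1) / z := by field_simp; ring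
        have a2 : -1 / (z - 1) - 1 = - z / (z - 1) := by field_simp; ring
        rw [a1, a2]; field_simp
      have h6 : 0 < (-1 / (z - 1) - 1).im := im_sub_one (im_neg_inv h1)
      rw [h5, tF_S (im_two h6), mul_div_cancel_left₀ _ (two_ne_zero), ← sF_T, sub_add_cancel,
        sF_S h1, show (z + 1) / 2 = (z - 1) / 2 + 1 by ring, tF_T]
      ring
    rw [e1, e3, sF_S hz]; ring
  · have := ((tF_lim.comp cusp_half).add (tF_lim.comp cusp_half')).add (sF_lim.const_mul 4096)
    simp only [mul_zero, add_zero] at this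
    refine this.congr fun z => ?_
    have h : ee (-((z + 1) / 2)) = - ee (-(z / 2)) := by
      rw [show -((z + 1) / 2) = -(z/2) + (-1/2) by ring, ee_add]
      have : ee (-1 / 2) = -1 := by
        rw [ee, show 2 * (π:ℂ) * Complex.I * (-1 / 2) = -(π * Complex.I) by ring, Complex.exp_neg,
          Complex.exp_pi_mul_I]; norm_num
      rw [this]; ring
    simp only [Function.comp]
    rw [h]; ring

lemma f10_eq {z : ℂ} (hz : 0 < z.im) : f10 z = 24 - (tF (z / 4) + tF ((z + 2) / 4)) := by
  have := U2 (im_half hz)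
  rw [show z / 2 / 2 = z / 4 by ring, show (z / 2 + 1) / 2 = (z + 2) / 4 by ring] at this
  unfold f10; linear_combination this

lemma f00_eq {z : ℂ} (hz : 0 < z.im) :
    f00 z = tF z - ∑ j ∈ Finset.range 4, tF ((z + j) / 4) := by
  unfold f00 f11
  rw [f10_eq hz, f10_eq (im_add_one hz)]
  simp [Finset.sum_range_succ]
  ring_nf

noncomputable def fV (x y : ℤ) (z : ℂ) : ℂ :=
  if x % 2 = 0 then (if y % 2 = 0 then f00 z else tF z) else (if y % 2 = 0 then f10 z else f11 z)

lemma fV_congr {x x' y y' : ℤ} (hx : x % 2 = x' % 2) (hy : y % 2 = y' % 2) (z : ℂ) :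
    fV x y z = fV x' y' z := by unfold fV; rw [hx, hy]

lemma fV_T (x y : ℤ) (z : ℂ) : fV x y (z + 1) = fV x (x + y) z := by
  unfold fV
  rcases Int.emod_two_eq_zero_or_one x with hx | hx <;>
    rcases Int.emod_two_eq_zero_or_one y with hy | hy <;>
    simp [hx, hy, Int.add_emod, tF_T, f00_T, f10_T2, f11]
  
lemma fV_S (x y : ℤ) {z : ℂ} (hz : 0 < z.im) : fV x y (-1 / z) = fV y (-x) z := by
  rw [fV_congr (x := y) (y := -x) rfl (show (-x) % 2 = x % 2 by omega)]
  unfold fV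
  rcases Int.emod_two_eq_zero_or_one x with hx | hx <;>
    rcases Int.emod_two_eq_zero_or_one y with hy | hy <;>
    simp [hx, hy, tF_S' hz, f00_S hz, f10_S hz, f11_S hz]

lemma fV_diff (x y : ℤ) {z : ℂ} (hz : 0 < z.im) : DifferentiableAt ℂ (fV x y) z := by
  unfold fV
  rcases Int.emod_two_eq_zero_or_one x with hx | hx <;>
    rcases Int.emod_two_eq_zero_or_one y with hy | hy <;>
    simp [hx, hy, tF_diff hz, f00_diff hz, f10_diff hz, f11_diff hz]
end

section
open scoped Real
open Filter Topology

noncomputable def mob (M : Matrix (Fin 2) (Fin 2) ℤ) (z : ℂ) : ℂ :=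
  (M 0 0 * z + M 0 1) / (M 1 0 * z + M 1 1)

lemma mob_den {M : Matrix (Fin 2) (Fin 2) ℤ} (hM : 0 < M.det) {z : ℂ} (hz : 0 < z.im) :
    (M 1 0 * z + M 1 1 : ℂ) ≠ 0 := by
  intro h
  have h1 := congrArg Complex.im h
  have h2 := congrArg Complex.re h
  simp at h1 h2
  have h3 : M 1 0 = 0 := by
    rcases h1 with h1 | h1
    · exact h1
    · exact absurd h1 hz.ne'
  rw [h3] at h2
  simp at h2
  rw [Matrix.det_fin_two, h3, h2] at hM
  simp at hM

lemma mob_im {M : Matrix (Fin 2) (Fin 2) ℤ} (hM : 0 < M.det) {z : ℂ} (hz : 0 < z.im) :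
    0 < (mob M z).im := by
  have h := mob_den hM hz
  have hn : 0 < Complex.normSq (M 1 0 * z + M 1 1) := Complex.normSq_pos.2 h
  have : (mob M z).im = (M.det * z.im) / Complex.normSq (M 1 0 * z + M 1 1) := by
    rw [mob, Complex.div_im]
    rw [← sub_div]
    congr 1
    simp [Matrix.det_fin_two]
    ring
  rw [this]
  have : (0:ℝ) < M.det := by exact_mod_cast hM
  positivity

lemma mob_mul {A B : Matrix (Fin 2) (Fin 2) ℤ} (hA : 0 < A.det) (hB : 0 < B.det) {z : ℂ}
    (hz : 0 < z.im) : mob (A * B) z = mob A (mob B z) := by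
  have h1 := mob_den hB hz
  have h2 := mob_den hA (mob_im hB hz)
  have h3 := mob_den (M := A * B) (by rw [Matrix.det_mul]; positivity) hz
  unfold mob at h2 ⊢
  rw [div_eq_div_iff h3 h2]
  simp [Matrix.mul_apply, Fin.sum_univ_two] at h3 ⊢
  field_simp
  ring

open Matrix MatrixGroups ModularGroup

lemma fV_SL (γ : SL(2, ℤ)) : ∀ (x y : ℤ) (z : ℂ), 0 < z.im →
    fV x y (mob γ z) = fV (x * γ 0 0 + y * γ 1 0) (x * γ 0 1 + y * γ 1 1) z := by
  have hd : ∀ g : SL(2, ℤ), 0 < (g : Matrix (Fin 2) (Fin 2) ℤ).det := fun g => by simp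
  have hγ : γ ∈ Subgroup.closure {S, T} := by
    rw [SpecialLinearGroup.SL2Z_generators]; trivial
  induction hγ using Subgroup.closure_induction with
  | mem g hg =>
    intro x y z hz
    rcases hg with rfl | rfl
    · have : mob (S : SL(2, ℤ)) z = -1 / z := by simp [mob, S]
      rw [this, fV_S _ _ hz]
      simp [S]
    · have : mob (T : SL(2, ℤ)) z = z + 1 := by simp [mob, T]
      rw [this, fV_T]
      simp [T]
  | one =>
    intro x y z hz
    simp [mob]
  | mul a b _ _ ha hb =>
    intro x y z hz
    change fV x y (mob (a.1 * b.1) z) = fV (x * (a.1 * b.1) 0 0 + y * (a.1 * b.1) 1 0) (x * (a.1 * b.1) 0 1 + y * (a.1 * b.1) 1 1) z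
    rw [mob_mul (hd a) (hd b) hz, ha _ _ _ (mob_im (hd b) hz), hb _ _ _ hz]
    simp only [Matrix.mul_apply, Fin.sum_univ_two]
    congr 1 <;> ring
  | inv a _ ha =>
    intro x y z hz
    have h := ha (x * (a⁻¹ : SL(2, ℤ)) 0 0 + y * (a⁻¹ : SL(2, ℤ)) 1 0) (x * (a⁻¹ : SL(2, ℤ)) 0 1 + y * (a⁻¹ : SL(2, ℤ)) 1 1) (mob (a⁻¹ : SL(2, ℤ)) z) (mob_im (hd _) hz)
    have e : mob (a.1 * (a⁻¹).1) z = z := by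
      have : a.1 * (a⁻¹).1 = 1 := congrArg Subtype.val (mul_inv_cancel a)
      rw [this]; simp [mob]
    rw [← mob_mul (hd _) (hd _) hz, e] at h
    rw [h]
    have hdet := a.det_coe
    rw [Matrix.det_fin_two] at hdet
    congr 1
    · simp [Matrix.adjugate_fin_two]
      linear_combination (-x) * hdet
    · simp [Matrix.adjugate_fin_two]
      linear_combination (-y) * hdet

open FixedDetMatrices

abbrev Dm (m : ℤ) := FixedDetMatrix (Fin 2) ℤ m

noncomputable def Gm (x y : ℤ) (z : ℂ) (M : Matrix (Fin 2) (Fin 2) ℤ) : ℂ :=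
  fV (x * M 1 1 - y * M 1 0) (-x * M 0 1 + y * M 0 0) (mob M z)

lemma Gm_smul (x y : ℤ) {z : ℂ} (hz : 0 < z.im) (γ : SL(2, ℤ)) {M : Matrix (Fin 2) (Fin 2) ℤ}
    (hM : 0 < M.det) : Gm x y z (γ * M) = Gm x y z M := by
  have hdet := γ.det_coe
  rw [Matrix.det_fin_two] at hdet
  unfold Gm
  rw [mob_mul (by simp) hM hz, fV_SL γ _ _ _ (mob_im hM hz)]
  simp only [Matrix.mul_apply, Fin.sum_univ_two]
  congr 1
  · linear_combination (x * M 1 1 - y * M 1 0) * hdet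
  · linear_combination (-x * M 0 1 + y * M 0 0) * hdet

lemma Gm_right (x y : ℤ) {z : ℂ} (hz : 0 < z.im) (γ : SL(2, ℤ)) {M : Matrix (Fin 2) (Fin 2) ℤ}
    (hM : 0 < M.det) :
    Gm (x * γ 0 0 + y * γ 1 0) (x * γ 0 1 + y * γ 1 1) z (M * γ) = Gm x y (mob γ z) M := by
  have hdet := γ.det_coe
  rw [Matrix.det_fin_two] at hdet
  unfold Gm
  rw [mob_mul hM (by simp) hz]
  simp only [Matrix.mul_apply, Fin.sum_univ_two]
  congr 1
  · linear_combination (x * M 1 1 - y * M 1 0) * hdet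
  · linear_combination (-x * M 0 1 + y * M 0 0) * hdet

lemma reduce_ex {m : ℤ} (A : Dm m) : ∃ γ : SL(2, ℤ), reduce A = γ • A := by
  induction A using reduce_rec with
  | step A h1 h2 =>
    obtain ⟨γ, h⟩ := h2
    rw [reduce_reduceStep h1] at h
    exact ⟨γ * (S * T ^ (-(A.1 0 0 / A.1 1 0))), by rw [h, reduceStep, mul_smul, mul_smul]⟩
  | base A h =>
    by_cases h1 : 0 < A.1 0 0
    · exact ⟨_, reduce_of_pos h h1⟩
    · exact ⟨T ^ (-(-A.1 0 1 / -A.1 1 1)) * (S * S), by rw [reduce_of_not_pos h h1, mul_smul, mul_smul]⟩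

lemma reps_unique {m : ℤ} (hm : 0 < m) {A B : Dm m} (hA : A ∈ reps m) (hB : B ∈ reps m)
    (γ : SL(2, ℤ)) (h : A = γ • B) : A = B := by
  obtain ⟨a1, a2, a3, a4⟩ := hA
  obtain ⟨b1, b2, b3, b4⟩ := hB
  have h' : A.1 = γ * B.1 := by rw [h, smul_coe]
  have hdA := A.2
  have hdB := B.2
  have hdet := γ.det_coe
  rw [Matrix.det_fin_two] at hdet hdA hdB
  have e00 : A.1 0 0 = γ 0 0 * B.1 0 0 + γ 0 1 * B.1 1 0 := by
    rw [h', Matrix.mul_apply, Fin.sum_univ_two]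
  have e01 : A.1 0 1 = γ 0 0 * B.1 0 1 + γ 0 1 * B.1 1 1 := by
    rw [h', Matrix.mul_apply, Fin.sum_univ_two]
  have e10 : A.1 1 0 = γ 1 0 * B.1 0 0 + γ 1 1 * B.1 1 0 := by
    rw [h', Matrix.mul_apply, Fin.sum_univ_two]
  have e11 : A.1 1 1 = γ 1 0 * B.1 0 1 + γ 1 1 * B.1 1 1 := by
    rw [h', Matrix.mul_apply, Fin.sum_univ_two]
  rw [a1, b1] at e10
  rw [b1] at e00
  rw [a1] at hdA
  rw [b1] at hdB
  have key : γ 1 0 = 0 ∧ γ 0 0 = 1 ∧ γ 1 1 = 1 ∧ γ 0 1 = 0 := by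
    generalize A.1 0 0 = a at *
    generalize A.1 0 1 = b at *
    generalize A.1 1 1 = d at *
    generalize B.1 0 0 = a' at *
    generalize B.1 0 1 = b' at *
    generalize B.1 1 1 = d' at *
    generalize γ 0 0 = p at *
    generalize γ 0 1 = q at *
    generalize γ 1 0 = r at *
    generalize γ 1 1 = s at *
    have hr : r = 0 := by
      have : r * a' = 0 := by linarith
      rcases mul_eq_zero.1 this with h | h
      · exact h
      · omega
    subst hr
    have hps : p * s = 1 := by linarith
    have hp : 0 < p := by
      have : 0 < p * a' := by linarith
      exact pos_of_mul_pos_left this b2.le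
    have hp1 : p = 1 := by
      rcases Int.mul_eq_one_iff_eq_one_or_neg_one.1 hps with h | h <;> omega
    subst hp1
    have hs : s = 1 := by linarith
    subst hs
    have hdpos : 0 < d' := by
      have : 0 < a' * d' := by linarith
      exact pos_of_mul_pos_right this b2.le
    have hdd : d = d' := by linarith
    subst hdd
    rw [abs_of_nonneg a3, abs_of_pos hdpos] at a4
    rw [abs_of_nonneg b3, abs_of_pos hdpos] at b4
    have hq : q = 0 := by
      by_contra hq
      rcases lt_or_gt_of_ne hq with h | h
      · nlinarith
      · nlinarith
    exact ⟨rfl, rfl, rfl, hq⟩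
  obtain ⟨k1, k2, k3, k4⟩ := key
  rw [k1, k3] at e11
  rw [k2, k4] at e00 e01
  ext i j
  fin_cases i <;> fin_cases j
  · simpa using e00
  · simpa using e01
  · simp [a1, b1]
  · simpa using e11

noncomputable def Vop (m : ℤ) (x y : ℤ) (z : ℂ) : ℂ := ∑ M : reps m, Gm x y z M.1.1

lemma Vop_SL {m : ℤ} (hm : 0 < m) (x y : ℤ) {z : ℂ} (hz : 0 < z.im) (γ : SL(2, ℤ)) :
    Vop m x y (mob γ z) = Vop m (x * γ 0 0 + y * γ 1 0) (x * γ 0 1 + y * γ 1 1) z := by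
  have hdet : ∀ M : Dm m, 0 < M.1.det := fun M => by rw [M.2]; exact hm
  let R : Dm m → Dm m := fun M => ⟨M.1 * γ, by rw [Matrix.det_mul, M.2, γ.det_coe, mul_one]⟩
  let s : reps m → reps m := fun M => ⟨reduce (R M.1), reduce_mem_reps hm.ne' _⟩
  have hinj : Function.Injective s := by
    intro M N h
    obtain ⟨g1, h1⟩ := reduce_ex (R M.1)
    obtain ⟨g2, h2⟩ := reduce_ex (R N.1)
    have h3 : g1 • R M.1 = g2 • R N.1 := by rw [← h1, ← h2]; exact congrArg Subtype.val h
    have h4 : R M.1 = (g1⁻¹ * g2) • R N.1 := by rw [mul_smul, ← h3, inv_smul_smul]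
    have h5 : M.1.1 * γ.1 = (g1⁻¹ * g2).1 * (N.1.1 * γ.1) := congrArg Subtype.val h4
    have h6 : M.1.1 = (g1⁻¹ * g2).1 * N.1.1 := by
      have e : γ.1 * (γ⁻¹).1 = 1 := congrArg Subtype.val (mul_inv_cancel γ)
      have := congrArg (· * (γ⁻¹).1) h5
      simp only [Matrix.mul_assoc] at this
      rw [e, Matrix.mul_one, Matrix.mul_one] at this
      exact this
    exact Subtype.ext (reps_unique hm M.2 N.2 (g1⁻¹ * g2) (Subtype.ext h6))
  have hbij : Function.Bijective s := Finite.injective_iff_bijective.1 hinj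
  unfold Vop
  rw [← Function.Bijective.sum_comp hbij
    (fun M : reps m => Gm (x * γ 0 0 + y * γ 1 0) (x * γ 0 1 + y * γ 1 1) z M.1.1)]
  refine Finset.sum_congr rfl fun M _ => ?_
  rw [← Gm_right x y hz γ (hdet M.1)]
  obtain ⟨g, hg⟩ := reduce_ex (R M.1)
  have : (s M).1.1 = g * (M.1.1 * γ) := by
    change (reduce (R M.1)).1 = _
    rw [hg]; rfl
  rw [this, Gm_smul _ _ hz g (by rw [Matrix.det_mul, γ.det_coe, mul_one]; exact hdet _)]

lemma Vop_congr (m : ℤ) {x x' y y' : ℤ} (hx : x % 2 = x' % 2) (hy : y % 2 = y' % 2) (z : ℂ) :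
    Vop m x y z = Vop m x' y' z := by
  unfold Vop Gm
  refine Finset.sum_congr rfl fun M _ => fV_congr ?_ ?_ _
  · exact Int.ModEq.sub (Int.ModEq.mul_right _ hx) (Int.ModEq.mul_right _ hy)
  · exact Int.ModEq.add (Int.ModEq.mul_right _ (Int.ModEq.neg hx)) (Int.ModEq.mul_right _ hy)

lemma Vop_S {m : ℤ} (hm : 0 < m) (x y : ℤ) {z : ℂ} (hz : 0 < z.im) :
    Vop m x y (-1 / z) = Vop m y x z := by
  have h : mob (S : SL(2, ℤ)) z = -1 / z := by simp [mob, S]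
  rw [← h, Vop_SL hm x y hz S]
  apply Vop_congr
  · simp [S]
  · simp [S]

lemma Vop_T {m : ℤ} (hm : 0 < m) (x y : ℤ) {z : ℂ} (hz : 0 < z.im) :
    Vop m x y (z + 1) = Vop m x (x + y) z := by
  have h : mob (T : SL(2, ℤ)) z = z + 1 := by simp [mob, T]
  rw [← h, Vop_SL hm x y hz T]
  simp [T]
end

section
open scoped Real
open Filter Topology FixedDetMatrices

lemma Vop_sum {m : ℕ} (hm : 0 < m) (x y : ℤ) (z : ℂ) :
    Vop m x y z = ∑ ad ∈ m.divisorsAntidiagonal, ∑ b ∈ Finset.range ad.2,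
      fV (x * ad.2) (-x * b + y * ad.1) ((ad.1 * z + b) / ad.2) := by
  rw [Finset.sum_sigma']
  unfold Vop
  symm
  have hdet : ∀ (a : (Σ _ : ℕ × ℕ, ℕ)), a ∈ (m.divisorsAntidiagonal.sigma fun ad => Finset.range ad.2) →
      (!![(a.1.1 : ℤ), (a.2 : ℤ); 0, (a.1.2 : ℤ)]).det = m := by
    intro a ha
    rw [Finset.mem_sigma, Nat.mem_divisorsAntidiagonal] at ha
    rw [Matrix.det_fin_two_of, ← ha.1.1]; simp
  refine Finset.sum_bij (fun a ha => (⟨⟨!![(a.1.1 : ℤ), (a.2 : ℤ); 0, (a.1.2 : ℤ)], hdet a ha⟩, ?_⟩ : reps m))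
    ?_ ?_ ?_ ?_
  · rw [Finset.mem_sigma, Nat.mem_divisorsAntidiagonal, Finset.mem_range] at ha
    refine ⟨by simp, ?_, by simp, ?_⟩
    · have : 0 < a.1.1 := by
        rcases Nat.eq_zero_or_pos a.1.1 with h | h
        · rw [h] at ha; simp at ha; omega
        · exact h
      simpa using this
    · simpa using ha.2
  · intros; exact Finset.mem_univ _
  · rintro ⟨⟨a, d⟩, b⟩ _ ⟨⟨a', d'⟩, b'⟩ _ h
    have h1 := congrArg (fun M : reps m => M.1.1) h
    have h00 := congrFun (congrFun h1 0) 0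
    have h01 := congrFun (congrFun h1 0) 1
    have h11 := congrFun (congrFun h1 1) 1
    simp at h00 h01 h11
    subst h00 h01 h11; rfl
  · rintro ⟨M, hM⟩ _
    have hd := M.2
    obtain ⟨h1, h2, h3, h4⟩ := hM
    rw [Matrix.det_fin_two, h1] at hd
    have h11 : 0 < M.1 1 1 := by
      have : 0 < M.1 0 0 * M.1 1 1 := by push_cast at hd; omega
      exact pos_of_mul_pos_right this h2.le
    rw [abs_of_nonneg h3, abs_of_pos h11] at h4
    refine ⟨⟨((M.1 0 0).toNat, (M.1 1 1).toNat), (M.1 0 1).toNat⟩, ?_, ?_⟩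
    · rw [Finset.mem_sigma, Nat.mem_divisorsAntidiagonal, Finset.mem_range]
      refine ⟨⟨?_, hm.ne'⟩, by simp; omega⟩
      zify
      rw [Int.toNat_of_nonneg h2.le, Int.toNat_of_nonneg h11.le]
      linarith
    · apply Subtype.ext
      apply Subtype.ext
      ext i j
      fin_cases i <;> fin_cases j <;> simp [h1, h2.le, h3, h11.le]
  · rintro ⟨⟨a, d⟩, b⟩ _
    simp [Gm, mob]

lemma orth {d : ℕ} (hd : 0 < d) (n : ℤ) :
    ∑ b ∈ Finset.range d, ee (n * b / d) = if (d : ℤ) ∣ n then (d : ℂ) else 0 := by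
  have hd0 : (d : ℂ) ≠ 0 := by exact_mod_cast hd.ne'
  have h1 : ∀ b : ℕ, ee (n * b / d) = ee (n / d) ^ b := by
    intro b; rw [ee_pow]; congr 1; ring
  simp_rw [h1]
  split_ifs with h
  · obtain ⟨k, rfl⟩ := h
    have : ee (((d * k : ℤ) : ℂ) / d) = 1 := by
      rw [← ee_int k]; congr 1; push_cast; field_simp
    rw [this]; simp
  · have hne : ee (n / d) ≠ 1 := by
      intro he
      rw [ee, Complex.exp_eq_one_iff] at he
      obtain ⟨k, hk⟩ := he
      apply h
      have hpi : (2 * π * Complex.I : ℂ) ≠ 0 := Complex.two_pi_I_ne_zero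
      have h2 : (n : ℂ) / d = k := mul_left_cancel₀ hpi (by rw [hk]; ring)
      rw [div_eq_iff hd0] at h2
      exact ⟨k, by have : n = k * d := by exact_mod_cast h2
                   rw [this, mul_comm]⟩
    have := geom_sum_eq hne d
    rw [this, ee_pow, show (d : ℂ) * (n / d) = n by field_simp, ee_int]; simp

lemma orth_one {d : ℕ} (hd : 0 < d) (w : ℂ) :
    ∑ b ∈ Finset.range d, ee (-((w + b) / d)) = if d = 1 then ee (-w) else 0 := by
  have h : ∀ b : ℕ, ee (-((w + b) / d)) = ee (-(w / d)) * ee ((-1 : ℤ) * b / d) := by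
    intro b; rw [← ee_add]; congr 1; push_cast; ring
  simp_rw [h]
  rw [← Finset.mul_sum, orth hd]
  have : ((d : ℤ) ∣ -1) ↔ d = 1 := by
    rw [Int.dvd_neg]; constructor
    · intro h; have := Int.eq_one_of_dvd_one (by omega) h; omega
    · rintro rfl; simp
  simp only [this]
  split_ifs with h1
  · subst h1; simp
  · simp

lemma fV_lim (x y : ℤ) : Tendsto (fun z => fV x y z - if x % 2 = 0 then ee (-z) else 0) cuspF
    (𝓝 (if x % 2 = 0 then 0 else 24)) := by
  unfold fV
  rcases Int.emod_two_eq_zero_or_one x with hx | hx <;>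
    rcases Int.emod_two_eq_zero_or_one y with hy | hy <;>
    simp [hx, hy, tF_lim, f00_lim, f10_lim, f11_lim]

lemma cusp_ad {a d : ℕ} (ha : 0 < a) (hd : 0 < d) (b : ℕ) :
    Tendsto (fun z : ℂ => (a * z + b) / d) cuspF cuspF := by
  refine (cusp_aff (a / d) (by positivity) (b / d)).congr fun z => by push_cast; ring

lemma Vop_lim_aux {m : ℕ} (hm : 0 < m) (x y : ℤ) :
    Tendsto (fun z => Vop m x y z - ∑ ad ∈ m.divisorsAntidiagonal,
      if (x * ad.2) % 2 = 0 then (if ad.2 = 1 then ee (-(ad.1 * z)) else 0) else 0) cuspF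
      (𝓝 (∑ ad ∈ m.divisorsAntidiagonal, ∑ b ∈ Finset.range ad.2, 
        if (x * ad.2) % 2 = 0 then 0 else 24)) := by
  have : Tendsto (fun z => ∑ ad ∈ m.divisorsAntidiagonal, ∑ b ∈ Finset.range ad.2,
      (fV (x * ad.2) (-x * b + y * ad.1) ((ad.1 * z + b) / ad.2) -
        if (x * ad.2) % 2 = 0 then ee (-((ad.1 * z + b) / ad.2)) else 0)) cuspF
      (𝓝 (∑ ad ∈ m.divisorsAntidiagonal, ∑ b ∈ Finset.range ad.2, 
        if (x * ad.2) % 2 = 0 then 0 else 24)) := by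
    refine tendsto_finsetSum _ fun ad had => tendsto_finsetSum _ fun b _ => ?_
    have h1 : 0 < ad.1 := Nat.pos_of_ne_zero (by rintro h; simp [h] at had; omega)
    have h2 : 0 < ad.2 := Nat.pos_of_ne_zero (by rintro h; simp [h] at had; omega)
    exact (fV_lim (x * ad.2) _).comp (cusp_ad h1 h2 b)
  refine this.congr fun z => ?_
  rw [Vop_sum hm, ← Finset.sum_sub_distrib]
  refine Finset.sum_congr rfl fun ad had => ?_
  have h2 : 0 < ad.2 := Nat.pos_of_ne_zero (by rintro h; simp [h] at had; omega)
  rw [Finset.sum_sub_distrib]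
  congr 1
  split_ifs with h3 h4
  · rw [orth_one h2, if_pos h4]
  · rw [orth_one h2, if_neg h4]
  · simp

lemma Vop_lim_zero {m : ℕ} (hm : 0 < m) :
    Tendsto (fun z => Vop m 0 1 z - ee (-(m * z))) cuspF (𝓝 0) := by
  have := Vop_lim_aux hm 0 1
  simp only [zero_mul, Int.zero_emod, if_true, Finset.sum_const_zero] at this
  refine this.congr fun z => ?_
  congr 1
  rw [Finset.sum_eq_single (m, 1)]
  · simp
  · rintro ⟨a, d⟩ h h2
    rw [if_neg]
    rintro rfl
    simp at h
    exact h2 (by rw [h.1])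
  · intro h; simp at h; omega

lemma Vop_lim_one {m : ℕ} (hm : 0 < m) (y : ℤ) : ∃ L, Tendsto (Vop m 1 y) cuspF (𝓝 L) := by
  refine ⟨_, (Vop_lim_aux hm 1 y).congr fun z => ?_⟩
  rw [Finset.sum_eq_zero, sub_zero]
  intro ad h
  split_ifs with h1 h2
  · rw [h2] at h1; simp at h1
  · rfl
  · rfl

lemma Vop_diff {m : ℕ} (hm : 0 < m) (x y : ℤ) {z : ℂ} (hz : 0 < z.im) :
    DifferentiableAt ℂ (Vop m x y) z := by
  rw [show Vop m x y = _ from funext (Vop_sum hm x y)]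
  refine DifferentiableAt.fun_sum fun ad had => DifferentiableAt.fun_sum fun b _ => ?_
  have h1 : 0 < ad.1 := Nat.pos_of_ne_zero (by rintro h; simp [h] at had; omega)
  have h2 : 0 < ad.2 := Nat.pos_of_ne_zero (by rintro h; simp [h] at had; omega)
  refine DifferentiableAt.comp (f := fun z : ℂ => (ad.1 * z + b) / ad.2) (g := fV _ _) z (fV_diff _ _ ?_) (by fun_prop)
  have : (((ad.1 : ℂ) * z + b) / ad.2).im = ad.1 * z.im / ad.2 := by simp [Complex.div_natCast_im]
  rw [this]; positivity
end

section
open scoped Real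
open Filter Topology PowerSeries

noncomputable def LD (W : PowerSeries ℂ) : PowerSeries ℂ := -(PowerSeries.derivative ℂ W) * W⁻¹

lemma LD_mul_self {W : PowerSeries ℂ} (h : constantCoeff W = 1) : W * LD W = -(PowerSeries.derivative ℂ W) := by
  unfold LD
  rw [mul_comm W, mul_assoc, PowerSeries.inv_mul_cancel W (by rw [h]; exact one_ne_zero), mul_one]

lemma LD_unique {W P : PowerSeries ℂ} (h : constantCoeff W = 1)
    (hP : W * P = -(PowerSeries.derivative ℂ W)) : LD W = P := by
  have hW : W ≠ 0 := by rintro rfl; simp at h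
  exact mul_left_cancel₀ hW (by rw [LD_mul_self h, hP])

lemma LD_mul {A B : PowerSeries ℂ} (hA : constantCoeff A = 1) (hB : constantCoeff B = 1) :
    LD (A * B) = LD A + LD B := by
  apply LD_unique (by rw [map_mul, hA, hB, mul_one])
  rw [Derivation.leibniz, smul_eq_mul, smul_eq_mul]
  linear_combination B * LD_mul_self hA + A * LD_mul_self hB

lemma LD_coeff {W : PowerSeries ℂ} (h : constantCoeff W = 1) (n : ℕ) :
    coeff n (LD W) = -((n + 1) * coeff (n + 1) W) -
      ∑ k ∈ Finset.range n, coeff (k + 1) W * coeff (n - 1 - k) (LD W) := by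
  have := congrArg (coeff n) (LD_mul_self h)
  rw [PowerSeries.coeff_mul, Finset.Nat.sum_antidiagonal_eq_sum_range_succ
    (fun i j => coeff i W * coeff j (LD W)), Finset.sum_range_succ'] at this
  rw [map_neg, PowerSeries.coeff_derivative] at this
  simp only [coeff_zero_eq_constantCoeff, h, one_mul, Nat.sub_zero] at this
  have e : ∑ k ∈ Finset.range n, coeff (k + 1) W * coeff (n - 1 - k) (LD W) =
    ∑ k ∈ Finset.range n, coeff (k + 1) W * coeff (n - (k + 1)) (LD W) := by
    refine Finset.sum_congr rfl fun k _ => by rw [Nat.sub_sub, add_comm 1 k]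
  rw [e]
  linear_combination this

lemma LD_tendsto {l : Filter ℂ} {W : ℂ → PowerSeries ℂ} {W0 : PowerSeries ℂ}
    (h : ∀ z, constantCoeff (W z) = 1) (h0 : constantCoeff W0 = 1)
    (hl : ∀ n, Tendsto (fun z => coeff n (W z)) l (𝓝 (coeff n W0))) (n : ℕ) :
    Tendsto (fun z => coeff n (LD (W z))) l (𝓝 (coeff n (LD W0))) := by
  induction n using Nat.strong_induction_on with
  | _ n ih =>
    rw [LD_coeff h0]
    simp_rw [LD_coeff (h _) n]
    refine ((hl (n + 1)).const_mul _).neg.sub (tendsto_finsetSum _ fun k hk => ?_)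
    rw [Finset.mem_range] at hk
    exact (hl (k + 1)).mul (ih _ (by omega))

lemma LD_diff {W : ℂ → PowerSeries ℂ} (h : ∀ z, constantCoeff (W z) = 1)
    (hl : ∀ n, Differentiable ℂ (fun z => coeff n (W z))) (n : ℕ) :
    Differentiable ℂ (fun z => coeff n (LD (W z))) := by
  induction n using Nat.strong_induction_on with
  | _ n ih =>
    simp_rw [LD_coeff (h _) n]
    refine ((hl (n + 1)).const_mul _).neg.sub (Differentiable.fun_sum fun k hk => ?_)
    rw [Finset.mem_range] at hk
    exact (hl (k + 1)).mul (ih _ (by omega))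

lemma LD_geom (u : ℂ) : LD (1 - C u * X) = PowerSeries.mk fun n => u ^ (n + 1) := by
  apply LD_unique (by simp)
  ext n
  rw [map_neg, PowerSeries.coeff_derivative, sub_mul, one_mul, map_sub, coeff_mk, mul_assoc, coeff_C_mul]
  cases n with
  | zero => simp [coeff_one]
  | succ n => rw [coeff_succ_X_mul, coeff_mk]; simp [coeff_one, coeff_X]; ring

structure IsCoef (α : ℕ → ℂ) : Prop where
  zero : α 0 = 0
  summ : ∀ r : ℝ, 0 ≤ r → r < 1 → Summable fun n => ‖α n‖ * r ^ n
  eq : ∀ z : ℂ, 0 < z.im → tF z = ee (-z) + ∑' n, α n * ee z ^ n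

noncomputable def gT (α : ℕ → ℂ) (m : ℕ) (h : ℂ) : ℂ := ∑' j, α (m + j) * h ^ j

lemma gT_summ {α : ℕ → ℂ} (hs : ∀ r : ℝ, 0 ≤ r → r < 1 → Summable fun n => ‖α n‖ * r ^ n)
    {r : ℝ} (h0 : 0 ≤ r) (h1 : r < 1) (m : ℕ) : Summable fun j => ‖α (m + j)‖ * r ^ j := by
  rcases h0.eq_or_lt with h | h
  · subst h
    apply summable_of_ne_finset_zero (s := {0})
    intro b hb
    simp at hb
    simp [hb]
  · have := (summable_nat_add_iff m).2 (hs r h0 h1)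
    have h2 := this.mul_right ((r ^ m)⁻¹)
    refine h2.congr fun j => ?_
    rw [add_comm m j, pow_add]
    have : r ^ m ≠ 0 := by positivity
    field_simp

lemma gT_summ' {α : ℕ → ℂ} (hs : ∀ r : ℝ, 0 ≤ r → r < 1 → Summable fun n => ‖α n‖ * r ^ n)
    {h : ℂ} (h1 : ‖h‖ < 1) (m : ℕ) : Summable fun j => ‖α (m + j) * h ^ j‖ := by
  refine (gT_summ hs (norm_nonneg h) h1 m).congr fun j => by simp

lemma gT_succ {α : ℕ → ℂ} (hs : ∀ r : ℝ, 0 ≤ r → r < 1 → Summable fun n => ‖α n‖ * r ^ n)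
    {h : ℂ} (h1 : ‖h‖ < 1) (m : ℕ) : gT α m h = α m + h * gT α (m + 1) h := by
  unfold gT
  rw [(gT_summ' hs h1 m).of_norm.tsum_eq_zero_add, ← tsum_mul_left]
  simp only [add_zero, pow_zero, mul_one]
  congr 1
  refine tsum_congr fun j => ?_
  rw [pow_succ, show m + (j + 1) = m + 1 + j by ring]; ring

lemma gT_bound {α : ℕ → ℂ} (hs : ∀ r : ℝ, 0 ≤ r → r < 1 → Summable fun n => ‖α n‖ * r ^ n)
    (m : ℕ) {h : ℂ} (hh : ‖h‖ ≤ 1 / 2) : ‖gT α m h‖ ≤ ∑' j, ‖α (m + j)‖ * (1 / 2) ^ j := by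
  have h1 : ‖h‖ < 1 := by linarith
  refine tsum_of_norm_bounded (gT_summ hs (by norm_num) (by norm_num) m).hasSum fun j => ?_
  rw [norm_mul, norm_pow]; gcongr

lemma hgT_lim {α : ℕ → ℂ} (hs : ∀ r : ℝ, 0 ≤ r → r < 1 → Summable fun n => ‖α n‖ * r ^ n)
    (m : ℕ) : Tendsto (fun z => ee z * gT α m (ee z)) cuspF (𝓝 0) := by
  refine Tendsto.zero_mul_isBoundedUnder_le ee_tendsto ?_
  refine ⟨∑' j, ‖α (m + j)‖ * (1 / 2) ^ j, ?_⟩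
  rw [eventually_map]
  have := ee_tendsto.eventually (Metric.closedBall_mem_nhds (0:ℂ) (by norm_num : (0:ℝ) < 1/2))
  filter_upwards [this] with z hz
  exact gT_bound hs m (by simpa using hz)

noncomputable def Qh (α : ℕ → ℂ) (h : ℂ) : PowerSeries ℂ :=
  PowerSeries.mk fun m => if m = 0 then 1 else -h * gT α m h
noncomputable def Wx (α : ℕ → ℂ) (x : ℂ) : PowerSeries ℂ :=
  PowerSeries.mk fun k => if k = 0 then 1 else if k = 1 then -x else α (k - 1)

lemma Qh_zero (α : ℕ → ℂ) (h : ℂ) : constantCoeff (Qh α h) = 1 := by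
  rw [← coeff_zero_eq_constantCoeff_apply, Qh, coeff_mk]; simp
lemma Wx_zero (α : ℕ → ℂ) (h : ℂ) : constantCoeff (Wx α h) = 1 := by
  rw [← coeff_zero_eq_constantCoeff_apply, Wx, coeff_mk]; simp

lemma W_factor {α : ℕ → ℂ} (hα : IsCoef α) {z : ℂ} (hz : 0 < z.im) :
    Wx α (tF z) = (1 - C (ee z)⁻¹ * X) * Qh α (ee z) := by
  have hn := ee_norm_lt hz
  have h0 := ee_ne z
  have ht : tF z = (ee z)⁻¹ + gT α 0 (ee z) := by
    rw [hα.eq z hz, ee_neg, gT]; simp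
  rw [ht]
  generalize ee z = h at *
  have h1 := gT_succ hα.summ hn 0
  rw [hα.zero, zero_add, zero_add] at h1
  ext n
  rw [sub_mul, one_mul, map_sub, mul_assoc, coeff_C_mul]
  rcases n with _ | _ | n
  · simp [Wx, Qh]
  · rw [coeff_succ_X_mul]; simp [Wx, Qh, h1]; ring
  · rw [coeff_succ_X_mul]
    simp only [Wx, Qh, coeff_mk]
    simp
    rw [gT_succ hα.summ hn (n + 1)]
    field_simp
    ring

noncomputable def Phi (α : ℕ → ℂ) (m : ℕ) (x : ℂ) : ℂ := coeff (m - 1) (LD (Wx α x))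

lemma Phi_eq {α : ℕ → ℂ} (hα : IsCoef α) {m : ℕ} (hm : 0 < m) {z : ℂ} (hz : 0 < z.im) :
    Phi α m (tF z) = ee (-(m * z)) + coeff (m - 1) (LD (Qh α (ee z))) := by
  rw [Phi, W_factor hα hz, LD_mul (by simp) (Qh_zero _ _), LD_geom, map_add, coeff_mk,
    Nat.sub_add_cancel hm, ← ee_neg, ee_pow, mul_neg]

lemma Phi_diff (α : ℕ → ℂ) (m : ℕ) : Differentiable ℂ (Phi α m) := by
  refine LD_diff (Wx_zero α) (fun n => ?_) (m - 1)
  simp only [Wx, coeff_mk]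
  rcases n with _ | _ | n <;> simp
  exact differentiable_id.neg

lemma Phi_lim {α : ℕ → ℂ} (hα : IsCoef α) {m : ℕ} (hm : 0 < m) :
    Tendsto (fun z => Phi α m (tF z) - ee (-(m * z))) cuspF (𝓝 0) := by
  have h : Tendsto (fun z => coeff (m - 1) (LD (Qh α (ee z)))) cuspF (𝓝 (coeff (m - 1) (LD 1))) := by
    refine LD_tendsto (fun z => Qh_zero _ _) (by simp) (fun n => ?_) _
    rcases n with _ | n
    · simp [Qh]
    · simp only [Qh, coeff_mk]
      have := (hgT_lim hα.summ (n + 1)).neg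
      simpa [coeff_one] using this
  have h1 : LD 1 = 0 := LD_unique (by simp) (by simp)
  rw [h1, map_zero] at h
  refine h.congr' ?_
  filter_upwards [cuspF_pos 0] with z hz
  rw [Phi_eq hα hm hz]; ring

lemma fV_01 : fV 0 1 = tF := by ext z; simp [fV]
lemma fV_10 : fV 1 0 = f10 := by ext z; simp [fV]
lemma fV_11 : fV 1 1 = f11 := by ext z; simp [fV]

theorem Hecke_Faber {α : ℕ → ℂ} (hα : IsCoef α) {m : ℕ} (hm : 0 < m) {z : ℂ} (hz : 0 < z.im) :
    Vop m 0 1 z = Phi α m (tF z) := by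
  have hm' : (0 : ℤ) < m := by exact_mod_cast hm
  let D (x y : ℤ) (z : ℂ) : ℂ := Vop m x y z - Phi α m (fV x y z)
  have hc : ∀ {x y x' y' : ℤ} (z : ℂ), x % 2 = x' % 2 → y % 2 = y' % 2 → D x y z = D x' y' z := by
    intro x y x' y' z h1 h2
    simp only [D]; rw [Vop_congr _ h1 h2, fV_congr h1 h2]
  have hS : ∀ x y z, 0 < z.im → D x y (-1 / z) = D y x z := by
    intro x y z hz
    simp only [D]
    rw [Vop_S hm' _ _ hz, fV_S _ _ hz, fV_congr (x := y) rfl (show (-x) % 2 = x % 2 by omega)]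
  have hT : ∀ x y z, 0 < z.im → D x y (z + 1) = D x (x + y) z := by
    intro x y z hz
    simp only [D]
    rw [Vop_T hm' _ _ hz, fV_T]
  have hd : ∀ x y, DifferentiableOn ℂ (D x y) {z | 0 < z.im} := by
    intro x y z hz
    exact ((Vop_diff hm x y hz).sub ((Phi_diff α m _).comp z (fV_diff x y hz))).differentiableWithinAt
  have hb : ∀ y, (y = 0 ∨ y = 1) → (D 1 y) =O[cuspF] fun _ => (1 : ℝ) := by
    intro y hy
    obtain ⟨L, hL⟩ := Vop_lim_one hm y
    have h1 : Tendsto (fV 1 y) cuspF (𝓝 24) := by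
      rcases hy with rfl | rfl
      · rw [fV_10]; exact f10_lim
      · rw [fV_11]; exact f11_lim
    have h2 : Tendsto (fun z => Phi α m (fV 1 y z)) cuspF (𝓝 (Phi α m 24)) :=
      ((Phi_diff α m).continuous.tendsto 24).comp h1
    exact (hL.sub h2).isBigO_one ℝ
  have h := key_prod (D 0 1) (D 1 0) (D 1 1) (hd _ _) (hd _ _) (hd _ _)
    (fun z hz => hT _ _ z hz) (fun z hz => hT _ _ z hz)
    (fun z hz => (hT _ _ z hz).trans (hc _ rfl rfl))
    (fun z hz => hS _ _ z hz) (fun z hz => hS _ _ z hz) (fun z hz => hS _ _ z hz)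
    ?_ (hb 0 (Or.inl rfl)) (hb 1 (Or.inr rfl))
  · have := h z hz
    simp only [D, fV_01] at this
    exact sub_eq_zero.1 this
  · have := (Vop_lim_zero hm).sub (Phi_lim hα hm)
    rw [sub_zero] at this
    refine this.congr fun z => ?_
    simp only [D, fV_01]; ring
end

section
open scoped Real
open Filter Topology PowerSeries

lemma Lsum {α : ℕ → ℂ} (hα : IsCoef α) {d : ℕ} (hd : 0 < d) {w : ℂ} (hw : 0 < w.im) :
    ∑ b ∈ Finset.range d, tF ((w + b) / d) =
      (if d = 1 then ee (-w) else 0) + d * ∑' r, α (d * r) * ee w ^ r := by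
  have hd0 : (d : ℂ) ≠ 0 := by exact_mod_cast hd.ne'
  have him : ∀ b : ℕ, 0 < ((w + b) / d : ℂ).im := by
    intro b
    have : ((w + b) / d : ℂ).im = w.im / d := by simp [Complex.div_natCast_im]
    rw [this]; positivity
  have hs : ∀ b : ℕ, Summable fun n => α n * ee ((w + b) / d) ^ n := by
    intro b
    have := (gT_summ' hα.summ (ee_norm_lt (him b)) 0).of_norm
    simpa using this
  rw [Finset.sum_congr rfl fun b _ => hα.eq _ (him b), Finset.sum_add_distrib, orth_one hd]
  congr 1
  rw [← Summable.tsum_finsetSum (fun b _ => hs b)]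
  have h1 : ∀ n : ℕ, ∑ b ∈ Finset.range d, α n * ee ((w + b) / d) ^ n =
      if d ∣ n then d * (α n * ee (n * w / d)) else 0 := by
    intro n
    have : ∀ b : ℕ, α n * ee ((w + b) / d) ^ n = α n * ee (n * w / d) * ee ((n : ℤ) * b / d) := by
      intro b
      rw [ee_pow, mul_assoc, ← ee_add]; congr 2; push_cast; ring
    simp_rw [this]
    rw [← Finset.mul_sum, orth hd]
    simp only [Int.natCast_dvd_natCast]
    split_ifs <;> ring
  simp_rw [h1]
  have hinj : Function.Injective (fun r : ℕ => d * r) := fun a b h => Nat.eq_of_mul_eq_mul_left hd h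
  rw [← tsum_mul_left, ← hinj.tsum_eq]
  · refine tsum_congr fun r => ?_
    rw [if_pos (Dvd.intro _ rfl), ee_pow]; congr 3; push_cast; field_simp
  · intro n hn
    rw [Function.mem_support] at hn
    by_cases h : d ∣ n
    · obtain ⟨k, rfl⟩ := h; exact ⟨k, rfl⟩
    · rw [if_neg h] at hn; exact absurd rfl hn

lemma sum_range_mul' (F : ℕ → ℂ) (k d : ℕ) : ∑ b ∈ Finset.range (k * d), F b =
    ∑ j ∈ Finset.range k, ∑ b ∈ Finset.range d, F (j * d + b) := by
  induction k with
  | zero => simp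
  | succ k ih => rw [Nat.succ_mul, Finset.sum_range_add, ih, Finset.sum_range_succ]

lemma Lsum00 {α : ℕ → ℂ} (hα : IsCoef α) {d : ℕ} (hd : 0 < d) {w : ℂ} (hw : 0 < w.im) :
    ∑ b ∈ Finset.range d, f00 ((w + b) / d) =
      (if d = 1 then ee (-w) else 0) + d * ∑' r, α (d * r) * ee w ^ r
        - 4 * d * ∑' r, α (4 * d * r) * ee w ^ r := by
  have hd0 : (d : ℂ) ≠ 0 := by exact_mod_cast hd.ne'
  have him : ∀ b : ℕ, 0 < ((w + b) / d : ℂ).im := by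
    intro b
    have : ((w + b) / d : ℂ).im = w.im / d := by simp [Complex.div_natCast_im]
    rw [this]; positivity
  rw [Finset.sum_congr rfl fun b _ => f00_eq (him b), Finset.sum_sub_distrib, Lsum hα hd hw]
  congr 1
  have h4 := Lsum hα (d := 4 * d) (by omega) hw
  rw [if_neg (by omega), zero_add] at h4
  push_cast at h4
  rw [← h4, sum_range_mul', Finset.sum_comm]
  refine Finset.sum_congr rfl fun j _ => Finset.sum_congr rfl fun b _ => congrArg tF ?_
  push_cast
  field_simp
  ring

noncomputable def bt (α : ℕ → ℂ) (d r : ℕ) : ℂ := if 2 ∣ d ∧ 2 ∣ r then -α (d * r) else α (d * r)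

lemma bt_norm (α : ℕ → ℂ) (d r : ℕ) : ‖bt α d r‖ = ‖α (d * r)‖ := by
  unfold bt; split_ifs <;> simp

lemma mul_summ {α : ℕ → ℂ} (hs : ∀ r : ℝ, 0 ≤ r → r < 1 → Summable fun n => ‖α n‖ * r ^ n)
    {d : ℕ} (hd : 0 < d) {h : ℂ} (h1 : ‖h‖ < 1) : Summable fun r => ‖α (d * r) * h ^ r‖ := by
  have hinj : Function.Injective (fun r : ℕ => d * r) := fun a b h => Nat.eq_of_mul_eq_mul_left hd h
  have h3 := (hs (‖h‖ ^ ((d : ℝ)⁻¹)) (by positivity)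
    (Real.rpow_lt_one (norm_nonneg _) h1 (by positivity))).comp_injective hinj
  refine h3.congr fun r => ?_
  simp only [Function.comp, norm_mul, norm_pow]
  rw [pow_mul, ← Real.rpow_natCast (‖h‖ ^ ((d : ℝ)⁻¹)) d, ← Real.rpow_mul (norm_nonneg _),
    inv_mul_cancel₀ (by exact_mod_cast hd.ne'), Real.rpow_one]

lemma bt_tsum {α : ℕ → ℂ} (hs : ∀ r : ℝ, 0 ≤ r → r < 1 → Summable fun n => ‖α n‖ * r ^ n)
    {d : ℕ} (hd : 0 < d) {h : ℂ} (h1 : ‖h‖ < 1) :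
    ∑' r, bt α d r * h ^ r = ∑' r, α (d * r) * h ^ r -
      if 2 ∣ d then 2 * ∑' r, α (2 * d * r) * (h ^ 2) ^ r else 0 := by
  by_cases h2 : 2 ∣ d
  · have e : ∀ r, bt α d r * h ^ r = α (d * r) * h ^ r -
      (if 2 ∣ r then 2 * (α (d * r) * h ^ r) else 0) := by
      intro r; unfold bt; by_cases h3 : 2 ∣ r
      · simp [h2, h3]; ring
      · simp [h3]
    simp_rw [e]
    have hh2 : ‖h ^ 2‖ < 1 := by rw [norm_pow]; exact pow_lt_one₀ (norm_nonneg _) h1 (by norm_num)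
    have hinj : Function.Injective (fun r : ℕ => 2 * r) := fun a b h => by simpa using h
    have hsupp : Function.support (fun r => (if 2 ∣ r then 2 * (α (d * r) * h ^ r) else 0)) ⊆
        Set.range (fun r : ℕ => 2 * r) := by
      intro n hn
      rw [Function.mem_support] at hn
      by_cases h : 2 ∣ n
      · obtain ⟨k, rfl⟩ := h; exact ⟨k, rfl⟩
      · rw [if_neg h] at hn; exact absurd rfl hn
    have hS := (mul_summ hs hd h1).of_norm
    rw [Summable.tsum_sub hS, if_pos h2, ← hinj.tsum_eq hsupp, ← tsum_mul_left]
    · congr 1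
      refine tsum_congr fun r => ?_
      rw [if_pos (Dvd.intro _ rfl), ← pow_mul]; congr 3; ring
    · refine ((hS.mul_left 2).indicator {r | 2 ∣ r}).congr fun r => ?_
      simp [Set.indicator]
  · have : ∀ r, bt α d r = α (d * r) := by intro r; unfold bt; rw [if_neg (by tauto)]
    simp [this, h2]

lemma Vop_exp {α : ℕ → ℂ} (hα : IsCoef α) {m : ℕ} (hm : 0 < m) {z : ℂ} (hz : 0 < z.im) :
    Vop m 0 1 z = ee (-(m * z)) + ∑ ad ∈ m.divisorsAntidiagonal,
      ad.2 * ∑' r, bt α ad.2 r * (ee z ^ ad.1) ^ r := by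
  rw [Vop_sum hm]
  have hn := ee_norm_lt hz
  have hpos : ∀ ad ∈ m.divisorsAntidiagonal, 0 < ad.1 ∧ 0 < ad.2 := by
    intro ad had
    exact ⟨Nat.pos_of_ne_zero (by rintro h; simp [h] at had; omega), 
      Nat.pos_of_ne_zero (by rintro h; simp [h] at had; omega)⟩
  have e1 : ∀ ad ∈ m.divisorsAntidiagonal, ∑ b ∈ Finset.range ad.2,
      fV (0 * ad.2) (-0 * b + 1 * ad.1) ((ad.1 * z + b) / ad.2) = 
      (if ad.2 = 1 then ee (-(ad.1 * z)) else 0) + ad.2 * ∑' r, α (ad.2 * r) * (ee z ^ ad.1) ^ r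
        - if 2 ∣ ad.1 then 4 * ad.2 * ∑' r, α (4 * ad.2 * r) * (ee z ^ ad.1) ^ r else 0 := by
    intro ad had
    obtain ⟨h1, h2⟩ := hpos ad had
    have hw : 0 < (ad.1 * z : ℂ).im := by
      have : (ad.1 * z : ℂ).im = ad.1 * z.im := by simp
      rw [this]; positivity
    have hp : ee z ^ ad.1 = ee (ad.1 * z) := ee_pow _ _
    rw [hp]
    by_cases h : 2 ∣ ad.1
    · rw [if_pos h, ← Lsum00 hα h2 hw]
      refine Finset.sum_congr rfl fun b _ => ?_
      have : (ad.1 : ℤ) % 2 = 0 := by omega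
      simp [fV, this]
    · rw [if_neg h, sub_zero, ← Lsum hα h2 hw]
      refine Finset.sum_congr rfl fun b _ => ?_
      have : (ad.1 : ℤ) % 2 = 1 := by omega
      simp [fV, this]
  have e2 : ∀ ad ∈ m.divisorsAntidiagonal, ad.2 * ∑' r, bt α ad.2 r * (ee z ^ ad.1) ^ r = 
      ad.2 * ∑' r, α (ad.2 * r) * (ee z ^ ad.1) ^ r -
      if 2 ∣ ad.2 then 2 * ad.2 * ∑' r, α (2 * ad.2 * r) * (ee z ^ (2 * ad.1)) ^ r else 0 := by
    intro ad had
    obtain ⟨h1, h2⟩ := hpos ad had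
    rw [bt_tsum hα.summ h2 (by rw [norm_pow]; exact pow_lt_one₀ (norm_nonneg _) hn h1.ne'),
      mul_comm 2 ad.1, pow_mul]
    split_ifs <;> ring
  rw [Finset.sum_congr rfl e1, Finset.sum_congr rfl e2, Finset.sum_sub_distrib, Finset.sum_sub_distrib,
    Finset.sum_add_distrib]
  have e3 : ∑ ad ∈ m.divisorsAntidiagonal, (if ad.2 = 1 then ee (-(ad.1 * z)) else 0) = ee (-(m * z)) := by
    rw [Finset.sum_eq_single (m, 1)]
    · simp
    · rintro ⟨a, d⟩ h h2
      rw [if_neg]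
      rintro rfl
      simp at h
      exact h2 (by rw [h.1])
    · intro h; simp at h; omega
  have e4 : ∑ ad ∈ m.divisorsAntidiagonal, (if 2 ∣ ad.1 then 4 * ad.2 * ∑' r, α (4 * ad.2 * r) * (ee z ^ ad.1) ^ r else 0)
      = ∑ ad ∈ m.divisorsAntidiagonal, (if 2 ∣ ad.2 then 2 * ad.2 * ∑' r, α (2 * ad.2 * r) * (ee z ^ (2 * ad.1)) ^ r else 0) := by
    rw [← Finset.sum_filter, ← Finset.sum_filter]
    refine Finset.sum_nbij' (fun ad => (ad.1 / 2, 2 * ad.2)) (fun ad => (2 * ad.1, ad.2 / 2)) ?_ ?_ ?_ ?_ ?_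
    · rintro ⟨a, d⟩ h
      simp only [Finset.mem_filter, Nat.mem_divisorsAntidiagonal] at h ⊢
      obtain ⟨⟨h1, h2⟩, k, rfl⟩ := h
      refine ⟨⟨?_, h2⟩, Dvd.intro _ rfl⟩
      rw [← h1]; simp; ring
    · rintro ⟨a, d⟩ h
      simp only [Finset.mem_filter, Nat.mem_divisorsAntidiagonal] at h ⊢
      obtain ⟨⟨h1, h2⟩, k, rfl⟩ := h
      refine ⟨⟨?_, h2⟩, Dvd.intro _ rfl⟩
      rw [← h1]; simp; ring
    · rintro ⟨a, d⟩ h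
      simp only [Finset.mem_filter] at h
      obtain ⟨_, k, rfl⟩ := h
      simp
    · rintro ⟨a, d⟩ h
      simp only [Finset.mem_filter] at h
      obtain ⟨_, k, rfl⟩ := h
      simp
    · rintro ⟨a, d⟩ h
      simp only [Finset.mem_filter] at h
      obtain ⟨_, k, rfl⟩ := h
      simp only [Nat.mul_div_cancel_left _ (by norm_num : 0 < 2)]
      push_cast
      rw [show 2 * (2 * (d : ℂ)) = 4 * d by ring]
      simp only [show 2 * (2 * d) = 4 * d by ring]
  rw [e3, e4]; ring

theorem LDQ_eq {α : ℕ → ℂ} (hα : IsCoef α) {m : ℕ} (hm : 0 < m) {z : ℂ} (hz : 0 < z.im) :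
    coeff (m - 1) (LD (Qh α (ee z))) = ∑ ad ∈ m.divisorsAntidiagonal,
      ad.2 * ∑' r, bt α ad.2 r * (ee z ^ ad.1) ^ r := by
  have h1 := Hecke_Faber hα hm hz
  rw [Phi_eq hα hm hz, Vop_exp hα hm hz] at h1
  exact (add_left_cancel h1).symm
end

section
open scoped Real NNReal ENNReal
open Filter Topology PowerSeries

lemma fps_gT {α : ℕ → ℂ} (hs : ∀ r : ℝ, 0 ≤ r → r < 1 → Summable fun n => ‖α n‖ * r ^ n) :
    HasFPowerSeriesOnBall (gT α 0) (.ofScalars ℂ α) 0 1 := by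
  constructor
  · refine le_of_forall_lt_imp_le_of_dense fun r hr ↦ ?_
    lift r to NNReal using hr.ne_top
    apply FormalMultilinearSeries.le_radius_of_summable
    have := hs r r.2 (by exact_mod_cast hr)
    simpa using this
  · simp
  · intro y hy
    rw [← ENNReal.coe_one, Metric.eball_coe, NNReal.coe_one, mem_ball_zero_iff] at hy
    have := (gT_summ' hs hy 0).of_norm.hasSum
    simpa [gT, mul_comm] using this

lemma coef_cauchy {α : ℕ → ℂ} (hs : ∀ r : ℝ, 0 ≤ r → r < 1 → Summable fun n => ‖α n‖ * r ^ n)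
    {r M : ℝ} (h0 : 0 < r) (h1 : r < 1) (hM : ∀ q : ℂ, ‖q‖ = r → ‖gT α 0 q‖ ≤ M) (n : ℕ) :
    ‖α n‖ ≤ M * r⁻¹ ^ n := by
  have hf := fps_gT hs
  lift r to NNReal using h0.le
  have hd : DifferentiableOn ℂ (gT α 0) (Metric.closedBall 0 r) := by
    refine hf.differentiableOn.mono ?_
    intro y hy
    rw [← ENNReal.coe_one, Metric.eball_coe, NNReal.coe_one, mem_ball_zero_iff]
    rw [mem_closedBall_zero_iff] at hy
    exact lt_of_le_of_lt hy h1
  have hf2 := hd.hasFPowerSeriesOnBall (by exact_mod_cast h0)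
  have heq := hf.hasFPowerSeriesAt.eq_formalMultilinearSeries hf2.hasFPowerSeriesAt
  have hn : ‖(FormalMultilinearSeries.ofScalars ℂ α : FormalMultilinearSeries ℂ ℂ ℂ) n‖ = ‖α n‖ := by
    simp
  rw [← hn, heq]
  refine (norm_cauchyPowerSeries_le _ _ _ _).trans ?_
  rw [abs_of_pos h0]
  gcongr
  have h2 : ∫ θ : ℝ in 0..2 * π, ‖gT α 0 (circleMap 0 r θ)‖ ≤ ∫ θ : ℝ in 0..2 * π, M := by
    apply intervalIntegral.integral_mono_on (by positivity)
    · apply Continuous.intervalIntegrable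
      apply Continuous.norm
      refine hd.continuousOn.comp_continuous (continuous_circleMap 0 r) ?_
      intro θ
      rw [mem_closedBall_zero_iff]; simp
    · simp
    · intro θ _
      exact hM _ (by simp)
  rw [intervalIntegral.integral_const, smul_eq_mul, sub_zero] at h2
  have hpi := Real.pi_pos
  rw [inv_mul_le_iff₀ (by positivity)]
  exact h2

lemma ee_surj {q : ℂ} (h0 : q ≠ 0) (h1 : ‖q‖ < 1) : ∃ z : ℂ, 0 < z.im ∧ ee z = q := by
  have h : ee (Complex.log q / (2 * π * Complex.I)) = q := by
    rw [ee, mul_div_cancel₀ _ Complex.two_pi_I_ne_zero, Complex.exp_log h0]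
  refine ⟨_, ?_, h⟩
  by_contra hc
  rw [← h, ee_norm, Real.exp_lt_one_iff] at h1
  have := Real.pi_pos
  nlinarith

lemma gT_norm {α : ℕ → ℂ} (hα : IsCoef α) {q : ℂ} (h0 : q ≠ 0) (h1 : ‖q‖ < 1) :
    ‖gT α 0 q‖ ≤ (Real.exp (24 / (1 - ‖q‖)) + 1) / ‖q‖ + 24 := by
  obtain ⟨z, hz, rfl⟩ := ee_surj h0 h1
  have e1 := hα.eq z hz
  rw [tF_GF hz, ee_neg] at e1
  have e2 : gT α 0 (ee z) = (GF (ee z) - 1) / ee z + 24 := by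
    have : gT α 0 (ee z) = ∑' n, α n * ee z ^ n := by simp [gT]
    rw [this, sub_div, one_div]; linear_combination -e1
  rw [e2]
  refine (norm_add_le _ _).trans ?_
  rw [norm_div]
  have : ‖(24 : ℂ)‖ = 24 := by simp
  rw [this]
  gcongr
  refine (norm_sub_le _ _).trans ?_
  rw [norm_one]
  gcongr
  exact GF_bound h1

lemma coef_growth {α : ℕ → ℂ} (hα : IsCoef α) {n : ℕ} {u : ℝ} (hu : 0 ≤ u) (hn : n ≤ u ^ 2) :
    ‖α n‖ ≤ 28 * Real.exp (25 * u + 48) := by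
  set r : ℝ := (u + 1) / (u + 2) with hr
  have h0 : 0 < r := by positivity
  have h1 : r < 1 := by rw [hr, div_lt_one (by positivity)]; linarith
  have h2 : 1 / 2 ≤ r := by rw [hr, div_le_div_iff₀ (by norm_num) (by positivity)]; linarith
  have h3 : 24 / (1 - r) = 24 * u + 48 := by
    have : 1 - r = 1 / (u + 2) := by rw [hr]; field_simp; ring
    rw [this]; field_simp; ring
  have h4 : r⁻¹ ≤ Real.exp (1 / (u + 1)) := by
    have : r⁻¹ = 1 / (u + 1) + 1 := by rw [hr]; field_simp; ring
    rw [this]; exact Real.add_one_le_exp _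
  have h5 : r⁻¹ ^ n ≤ Real.exp u := by
    calc r⁻¹ ^ n ≤ Real.exp (1 / (u + 1)) ^ n := by gcongr
      _ = Real.exp (n * (1 / (u + 1))) := by rw [Real.exp_nat_mul]
      _ ≤ Real.exp u := by
        rw [Real.exp_le_exp, mul_one_div, div_le_iff₀ (by positivity)]; nlinarith
  have hM : ∀ q : ℂ, ‖q‖ = r → ‖gT α 0 q‖ ≤ 28 * Real.exp (24 * u + 48) := by
    intro q hq
    have := gT_norm hα (q := q) (by rintro rfl; simp at hq; linarith) (by rw [hq]; exact h1)
    rw [hq, h3] at this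
    refine this.trans ?_
    have he : 1 ≤ Real.exp (24 * u + 48) := Real.one_le_exp (by positivity)
    have : (Real.exp (24 * u + 48) + 1) / r ≤ (Real.exp (24 * u + 48) + 1) / (1 / 2) := by gcongr
    linarith
  refine (coef_cauchy hα.summ h0 h1 hM n).trans ?_
  calc 28 * Real.exp (24 * u + 48) * r⁻¹ ^ n ≤ 28 * Real.exp (24 * u + 48) * Real.exp u := by gcongr
    _ = _ := by rw [mul_assoc, ← Real.exp_add]; ring_nf

noncomputable def C0 : ℝ := 28 * Real.exp 48

lemma bt_growth {α : ℕ → ℂ} (hα : IsCoef α) (d r : ℕ) : ‖bt α d r‖ ≤ C0 * Real.exp 13 ^ (d + r) := by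
  rw [bt_norm]
  refine (coef_growth hα (u := (d + r) / 2) (by positivity) ?_).trans ?_
  · push_cast; nlinarith [sq_nonneg ((d : ℝ) - r)]
  · rw [C0, ← Real.exp_nat_mul, mul_assoc, ← Real.exp_add]
    have : (0 : ℝ) ≤ d + r := by positivity
    exact mul_le_mul_of_nonneg_left (Real.exp_le_exp.2 (by push_cast; linarith)) (by norm_num)

noncomputable def Tt (α : ℕ → ℂ) (p h : ℂ) (d r a : ℕ) : ℂ := bt α d r * ((p ^ d * h ^ r) ^ a / a)

lemma bt_zero_left {α : ℕ → ℂ} (h : α 0 = 0) (r : ℕ) : bt α 0 r = 0 := by simp [bt, h]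
lemma bt_zero_right {α : ℕ → ℂ} (h : α 0 = 0) (r : ℕ) : bt α r 0 = 0 := by simp [bt, h]

noncomputable def x0 : ℝ := Real.exp (-15)

lemma Tt_bound {α : ℕ → ℂ} (hα : IsCoef α) {p h : ℂ} (hp : ‖p‖ ≤ x0) (hh : ‖h‖ ≤ x0) (d r a : ℕ) :
    ‖Tt α p h d r a‖ ≤ C0 * Real.exp 2 * (Real.exp (-2) ^ d * Real.exp (-2) ^ r * Real.exp (-2) ^ a) := by
  have hC : 0 < C0 := by unfold C0; positivity
  have hC' : 0 ≤ C0 * Real.exp 2 * (Real.exp (-2) ^ d * Real.exp (-2) ^ r * Real.exp (-2) ^ a) := by positivity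
  unfold Tt
  rcases Nat.eq_zero_or_pos d with rfl | hd
  · rw [bt_zero_left hα.zero]; simpa using hC'
  rcases Nat.eq_zero_or_pos r with rfl | hr
  · rw [bt_zero_right hα.zero]; simpa using hC'
  rcases Nat.eq_zero_or_pos a with rfl | ha
  · simpa using hC'
  have h1 : ‖(p ^ d * h ^ r) ^ a / (a : ℂ)‖ ≤ Real.exp (-15) ^ ((d + r) * a) := by
    rw [norm_div, norm_pow, norm_mul, norm_pow, norm_pow, pow_mul, pow_add]
    have : (1:ℝ) ≤ ‖(a : ℂ)‖ := by simp; exact_mod_cast ha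
    refine (div_le_self (by positivity) this).trans ?_
    have e : Real.exp (-15) = x0 := rfl
    have hx0 : 0 < x0 := Real.exp_pos _
    rw [e]
    gcongr
  rw [norm_mul]
  calc ‖bt α d r‖ * ‖(p ^ d * h ^ r) ^ a / (a : ℂ)‖
      ≤ (C0 * Real.exp 13 ^ (d + r)) * Real.exp (-15) ^ ((d + r) * a) := by
        gcongr; exact bt_growth hα d r
    _ ≤ (C0 * Real.exp 13 ^ ((d + r) * a)) * Real.exp (-15) ^ ((d + r) * a) := by
        gcongr
        · exact Real.one_le_exp (by norm_num)
        · exact Nat.le_mul_of_pos_right _ ha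
    _ = C0 * Real.exp (-2) ^ ((d + r) * a) := by
        rw [mul_assoc, ← mul_pow, ← Real.exp_add]; norm_num
    _ ≤ C0 * Real.exp (-2) ^ (d + r + a - 1) := by
        have : d + r + a - 1 ≤ (d + r) * a := by
          obtain ⟨a, rfl⟩ := Nat.exists_eq_add_of_le ha
          obtain ⟨d, rfl⟩ := Nat.exists_eq_add_of_le hd
          have e : (1 + d + r) * (1 + a) = 1 + d + r + a + d * a + r * a := by ring
          rw [e]; omega
        exact mul_le_mul_of_nonneg_left (pow_le_pow_of_le_one (by positivity) (by rw [Real.exp_le_one_iff]; norm_num) this) hC.le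
    _ = _ := by
        have : d + r + a = (d + r + a - 1) + 1 := by omega
        rw [← pow_add, ← pow_add, this, pow_succ (n := d + r + a - 1)]
        simp only [Nat.add_sub_cancel]
        rw [mul_assoc C0, mul_comm (Real.exp (-2) ^ _) (Real.exp (-2)), ← mul_assoc (Real.exp 2), ← Real.exp_add]
        norm_num

lemma Tt_summ {α : ℕ → ℂ} (hα : IsCoef α) {p h : ℂ} (hp : ‖p‖ ≤ x0) (hh : ‖h‖ ≤ x0) :
    Summable fun t : (ℕ × ℕ) × ℕ => ‖Tt α p h t.1.1 t.1.2 t.2‖ := by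
  have g : Summable fun n : ℕ => Real.exp (-2) ^ n :=
    summable_geometric_of_lt_one (by positivity) (by rw [Real.exp_lt_one_iff]; norm_num)
  have g2 := (g.mul_of_nonneg g (fun _ => by positivity) (fun _ => by positivity))
  have g3 := (g2.mul_of_nonneg g (fun _ => by simp only [Pi.zero_apply]; positivity) (fun _ => by simp only [Pi.zero_apply]; positivity)).mul_left (C0 * Real.exp 2)
  exact g3.of_nonneg_of_le (fun _ => norm_nonneg _) fun t => Tt_bound hα hp hh _ _ _
end

section
open scoped Real
open Filter Topology PowerSeries

lemma x0_pos : 0 < x0 := Real.exp_pos _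
lemma x0_lt : x0 < 1 / 8 := by
  have : x0 = (Real.exp 15)⁻¹ := by rw [x0, Real.exp_neg]
  rw [this, one_div]
  have := Real.add_one_le_exp (15 : ℝ)
  apply inv_strictAnti₀ <;> linarith

lemma log_sum {α : ℕ → ℂ} (hα : IsCoef α) {p h : ℂ} (hp : ‖p‖ ≤ x0) (hh : ‖h‖ ≤ x0) :
    HasSum (fun dr : ℕ × ℕ => -(bt α dr.1 dr.2 * Complex.log (1 - p ^ dr.1 * h ^ dr.2)))
      (∑' t : (ℕ × ℕ) × ℕ, Tt α p h t.1.1 t.1.2 t.2) := by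
  have hs := (Tt_summ hα hp hh).of_norm.hasSum
  refine hs.prod_fiberwise fun dr => ?_
  obtain ⟨d, r⟩ := dr
  have hx := x0_lt
  have h0 := x0_pos
  simp only [Tt]
  rcases Nat.eq_zero_or_pos d with rfl | hd
  · rw [bt_zero_left hα.zero]; simpa using hasSum_zero
  have : ‖p ^ d * h ^ r‖ < 1 := by
    rw [norm_mul, norm_pow, norm_pow]
    have h1 : ‖p‖ ^ d < 1 := pow_lt_one₀ (norm_nonneg _) (by linarith) hd.ne'
    have h2 : ‖h‖ ^ r ≤ 1 := pow_le_one₀ (norm_nonneg _) (by linarith)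
    nlinarith [norm_nonneg p, norm_nonneg h, pow_nonneg (norm_nonneg p) d, pow_nonneg (norm_nonneg h) r]
  have := (Complex.hasSum_taylorSeries_neg_log this).mul_left (bt α d r)
  simpa [mul_neg] using this

noncomputable def vv (α : ℕ → ℂ) (h : ℂ) (m : ℕ) : ℂ := coeff (m - 1) (LD (Qh α h)) / m

lemma V_sum {α : ℕ → ℂ} (hα : IsCoef α) {p z : ℂ} (hz : 0 < z.im) (hp : ‖p‖ ≤ x0) (hh : ‖ee z‖ ≤ x0) :
    HasSum (fun m : ℕ => vv α (ee z) m * p ^ m) (∑' t : (ℕ × ℕ) × ℕ, Tt α p (ee z) t.1.1 t.1.2 t.2) := by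
  have hs := (Tt_summ hα hp hh).of_norm.hasSum
  let e : (ℕ × ℕ) × ℕ ≃ (ℕ × ℕ) × ℕ :=
    ⟨fun t => ((t.1.2, t.2), t.1.1), fun t => ((t.2, t.1.1), t.1.2), fun _ => rfl, fun _ => rfl⟩
  have hs1 := (e.hasSum_iff).2 hs
  have hs2 : HasSum (fun ad : ℕ × ℕ => p ^ (ad.1 * ad.2) / ad.1 * ∑' r, bt α ad.2 r * (ee z ^ ad.1) ^ r)
      (∑' t : (ℕ × ℕ) × ℕ, Tt α p (ee z) t.1.1 t.1.2 t.2) := by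
    refine hs1.prod_fiberwise fun ad => ?_
    obtain ⟨a, d⟩ := ad
    have : (fun r => p ^ (a * d) / a * (bt α d r * (ee z ^ a) ^ r)) = fun r => ((fun t : (ℕ × ℕ) × ℕ => Tt α p (ee z) t.1.1 t.1.2 t.2) ∘ e) ((a, d), r) := by
      ext r
      simp only [Function.comp, e, Equiv.coe_fn_mk, Tt]
      rw [mul_pow, ← pow_mul, ← pow_mul, ← pow_mul, mul_comm r a, mul_comm d a]; ring
    have hsm : Summable fun r => p ^ (a * d) / a * (bt α d r * (ee z ^ a) ^ r) := by
      rw [this]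
      exact hs1.summable.prod_factor (a, d)
    rw [← this, ← tsum_mul_left]
    exact hsm.hasSum
  have hs3 := hs2.tsum_fiberwise (fun ad => ad.1 * ad.2)
  suffices hfun : ∀ m : ℕ, vv α (ee z) m * p ^ m = ∑' b : ((fun ad : ℕ × ℕ => ad.1 * ad.2) ⁻¹' {m}),
      p ^ (b.1.1 * b.1.2) / b.1.1 * ∑' r, bt α b.1.2 r * (ee z ^ b.1.1) ^ r by
    rw [funext hfun]; exact hs3
  intro m
  rcases Nat.eq_zero_or_pos m with rfl | hm
  · have : ∀ b : ((fun ad : ℕ × ℕ => ad.1 * ad.2) ⁻¹' {0}), p ^ (b.1.1 * b.1.2) / b.1.1 * ∑' r, bt α b.1.2 r * (ee z ^ b.1.1) ^ r = 0 := by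
      rintro ⟨⟨a, d⟩, hb⟩
      simp only [Set.mem_preimage, Set.mem_singleton_iff, mul_eq_zero] at hb
      rcases hb with rfl | rfl
      · simp
      · simp [bt_zero_left hα.zero]
    rw [tsum_congr this]; simp [vv]
  · have : ((fun ad : ℕ × ℕ => ad.1 * ad.2) ⁻¹' {m}) = (m.divisorsAntidiagonal : Set (ℕ × ℕ)) := by
      ext x; simp [Nat.mem_divisorsAntidiagonal, hm.ne']
    rw [this, Finset.tsum_subtype' m.divisorsAntidiagonal (fun ad : ℕ × ℕ => p ^ (ad.1 * ad.2) / ad.1 * ∑' r, bt α ad.2 r * (ee z ^ ad.1) ^ r), vv, LDQ_eq hα hm hz, Finset.sum_div, Finset.sum_mul]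
    refine Finset.sum_congr rfl fun ad had => ?_
    obtain ⟨h1, h2⟩ := Nat.mem_divisorsAntidiagonal.1 had
    subst h1
    have ha : (ad.1 : ℂ) ≠ 0 := by rintro h; simp at h; simp [h] at hm
    have hd : (ad.2 : ℂ) ≠ 0 := by rintro h; simp at h; simp [h] at hm
    push_cast
    field_simp

/-- derivative of a power series -/
lemma ps_deriv {w : ℕ → ℂ} {ρ : ℝ} (hρ : 0 < ρ) (hw : Summable fun n => ‖w n‖ * (2 * ρ) ^ n) :
    (Summable fun n => ‖((n + 1 : ℕ) : ℂ) * w (n + 1)‖ * ρ ^ n) ∧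
    ∀ p : ℂ, ‖p‖ < ρ → HasDerivAt (fun p => ∑' n, w n * p ^ n) (∑' n, ((n + 1 : ℕ) : ℂ) * w (n + 1) * p ^ n) p := by
  have hu : Summable fun n : ℕ => ‖w n‖ * (n * ρ ^ (n - 1)) := by
    refine (hw.mul_right ρ⁻¹).of_nonneg_of_le (fun n => by positivity) fun n => ?_
    rw [mul_assoc]
    refine mul_le_mul_of_nonneg_left ?_ (norm_nonneg _)
    rcases n with _ | n
    · simp; positivity
    · rw [mul_pow, pow_succ ρ, Nat.add_sub_cancel]
      have : ((n + 1 : ℕ) : ℝ) ≤ 2 ^ (n + 1) := by exact_mod_cast Nat.lt_two_pow_self.le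
      have e : 2 ^ (n + 1) * (ρ ^ n * ρ) * ρ⁻¹ = 2 ^ (n + 1) * ρ ^ n := by field_simp
      rw [e]; gcongr
  have h1 : Summable fun n => ‖((n + 1 : ℕ) : ℂ) * w (n + 1)‖ * ρ ^ n := by
    refine ((summable_nat_add_iff 1).2 hu).congr fun n => ?_
    rw [norm_mul, Complex.norm_natCast, Nat.add_sub_cancel]; ring
  refine ⟨h1, fun p hp => ?_⟩
  have hd := hasDerivAt_tsum_of_isPreconnected (g := fun n (p : ℂ) => w n * p ^ n)
    (g' := fun n p => w n * (n * p ^ (n - 1))) (t := Metric.ball 0 ρ) (y₀ := 0) (y := p) hu Metric.isOpen_ball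
    (convex_ball (0:ℂ) ρ).isPreconnected
    (fun n y _ => (hasDerivAt_pow n y).const_mul (w n))
    (fun n y hy => by
      rw [norm_mul, norm_mul, norm_pow, Complex.norm_natCast]
      rw [mem_ball_zero_iff] at hy
      gcongr)
    (by simpa using hρ)
    (by
      apply summable_of_ne_finset_zero (s := {0})
      intro b hb
      simp at hb
      simp [hb])
    (by simpa using hp)
  have hsm : Summable fun n => w n * (n * p ^ (n - 1)) := by
    refine hu.of_norm_bounded fun n => ?_
    rw [norm_mul, norm_mul, norm_pow, Complex.norm_natCast]
    gcongr
  have e : ∑' n, w n * (n * p ^ (n - 1)) = ∑' n, ((n + 1 : ℕ) : ℂ) * w (n + 1) * p ^ n := by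
    rw [hsm.tsum_eq_zero_add]
    simp only [Nat.cast_zero, zero_mul, mul_zero, zero_add, Nat.add_sub_cancel]
    exact tsum_congr fun n => by ring
  rw [← e]; exact hd

lemma q_summ {α : ℕ → ℂ} (hα : IsCoef α) {h : ℂ} (hh : ‖h‖ ≤ x0) :
    Summable fun n => ‖coeff n (Qh α h)‖ * x0 ^ n := by
  have hx := x0_lt
  have h0 := x0_pos
  have hA := hα.summ (1 / 2) (by norm_num) (by norm_num)
  set A := ∑' n, ‖α n‖ * (1 / 2 : ℝ) ^ n with hAdef
  have hA0 : 0 ≤ A := tsum_nonneg fun n => by positivity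
  have key : ∀ n, ‖coeff n (Qh α h)‖ ≤ (A + 1) * 2 ^ n := by
    intro n
    rw [Qh, coeff_mk]
    split_ifs with hn
    · subst hn; simp; exact hA0
    · rw [norm_mul, norm_neg]
      have h1 : ‖gT α n h‖ ≤ A * 2 ^ n := by
        refine (gT_bound hα.summ n (by linarith)).trans ?_
        have e : ∀ j, ‖α (n + j)‖ * (1 / 2 : ℝ) ^ j = ‖α (j + n)‖ * (1 / 2 : ℝ) ^ (j + n) * 2 ^ n := by
          intro j
          rw [pow_add, add_comm n j]
          have : (1 / 2 : ℝ) ^ n * 2 ^ n = 1 := by rw [← mul_pow]; norm_num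
          rw [mul_assoc, mul_assoc, this, mul_one]
        rw [tsum_congr e, tsum_mul_right]
        gcongr
        rw [hAdef, ← hA.sum_add_tsum_nat_add n]
        have : 0 ≤ ∑ i ∈ Finset.range n, ‖α i‖ * (1 / 2 : ℝ) ^ i := Finset.sum_nonneg fun i _ => by positivity
        linarith
      have h2 : (0:ℝ) ≤ 2 ^ n := by positivity
      have h3 : ‖h‖ ≤ 1 := by linarith
      calc ‖h‖ * ‖gT α n h‖ ≤ 1 * (A * 2 ^ n) := by gcongr
        _ ≤ _ := by nlinarith
  have g : Summable fun n : ℕ => (A + 1) * (2 * x0) ^ n :=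
    (summable_geometric_of_lt_one (by positivity) (by linarith)).mul_left _
  refine g.of_nonneg_of_le (fun n => by positivity) fun n => ?_
  rw [mul_pow, ← mul_assoc]
  gcongr
  exact key n

theorem Q_exp {α : ℕ → ℂ} (hα : IsCoef α) {p z : ℂ} (hz : 0 < z.im) (hp : ‖p‖ < x0 / 2) (hh : ‖ee z‖ ≤ x0) :
    ∑' n, coeff n (Qh α (ee z)) * p ^ n = Complex.exp (-∑' m, vv α (ee z) m * p ^ m) := by
  have h0 := x0_pos
  have hρ : 0 < x0 / 2 := by positivity
  have hq := q_summ hα hh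
  have hv : Summable fun n => ‖vv α (ee z) n‖ * x0 ^ n := by
    have hx : ‖(x0 : ℂ)‖ = x0 := by simp [abs_of_pos h0]
    have := (V_sum hα (p := (x0 : ℂ)) hz hx.le hh).summable.norm
    refine this.congr fun n => ?_
    rw [norm_mul, norm_pow, hx]
  have e2 : x0 = 2 * (x0 / 2) := by ring
  rw [e2] at hq hv
  obtain ⟨hq1, hq2⟩ := ps_deriv hρ hq
  obtain ⟨hv1, hv2⟩ := ps_deriv hρ hv
  have hvc : ∀ n : ℕ, ((n + 1 : ℕ) : ℂ) * vv α (ee z) (n + 1) = coeff n (LD (Qh α (ee z))) := by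
    intro n
    have : ((n + 1 : ℕ) : ℂ) ≠ 0 := by exact_mod_cast n.succ_ne_zero
    rw [vv, Nat.add_sub_cancel]; field_simp
  simp only [hvc] at hv1 hv2
  set Q : ℂ → ℂ := fun p => ∑' n, coeff n (Qh α (ee z)) * p ^ n with hQ
  set V : ℂ → ℂ := fun p => ∑' n, vv α (ee z) n * p ^ n with hV
  have hqq : ∀ y : ℂ, ‖y‖ < x0 / 2 → Summable fun n => ‖coeff n (Qh α (ee z)) * y ^ n‖ := by
    intro y hy
    refine hq.of_nonneg_of_le (fun _ => norm_nonneg _) fun n => ?_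
    rw [norm_mul, norm_pow]; gcongr; linarith
  have hll : ∀ y : ℂ, ‖y‖ < x0 / 2 → Summable fun n => ‖coeff n (LD (Qh α (ee z))) * y ^ n‖ := by
    intro y hy
    refine hv1.of_nonneg_of_le (fun _ => norm_nonneg _) fun n => ?_
    rw [norm_mul, norm_pow]; gcongr
  have hmul : ∀ y : ℂ, ‖y‖ < x0 / 2 → Q y * (∑' n, coeff n (LD (Qh α (ee z))) * y ^ n) =
      -∑' n, ((n + 1 : ℕ) : ℂ) * coeff (n + 1) (Qh α (ee z)) * y ^ n := by
    intro y hy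
    rw [hQ, tsum_mul_tsum_eq_tsum_sum_antidiagonal_of_summable_norm (hqq y hy) (hll y hy), ← tsum_neg]
    refine tsum_congr fun n => ?_
    have := congrArg (coeff n) (LD_mul_self (Qh_zero α (ee z)))
    rw [PowerSeries.coeff_mul, map_neg, PowerSeries.coeff_derivative] at this
    have e : ∑ kl ∈ Finset.HasAntidiagonal.antidiagonal n, coeff kl.1 (Qh α (ee z)) * y ^ kl.1 * (coeff kl.2 (LD (Qh α (ee z))) * y ^ kl.2) =
        (∑ kl ∈ Finset.HasAntidiagonal.antidiagonal n, coeff kl.1 (Qh α (ee z)) * coeff kl.2 (LD (Qh α (ee z)))) * y ^ n := by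
      rw [Finset.sum_mul]
      refine Finset.sum_congr rfl fun kl hkl => ?_
      rw [← Finset.HasAntidiagonal.mem_antidiagonal.1 hkl, pow_add]; ring
    rw [e, this]; push_cast; ring
  have hder : ∀ y ∈ Metric.ball (0:ℂ) (x0 / 2), HasDerivAt (fun p => Q p * Complex.exp (V p)) 0 y := by
    intro y hy
    rw [mem_ball_zero_iff] at hy
    have := (hq2 y hy).mul (hv2 y hy).cexp
    have e : (∑' n, ((n + 1 : ℕ) : ℂ) * coeff (n + 1) (Qh α (ee z)) * y ^ n) * Complex.exp (V y) +
        Q y * (Complex.exp (V y) * ∑' n, coeff n (LD (Qh α (ee z))) * y ^ n) = 0 := by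
      linear_combination Complex.exp (V y) * hmul y hy
    rw [← e]
    exact this
  have hconst := Metric.isOpen_ball.is_const_of_deriv_eq_zero (convex_ball (0:ℂ) (x0 / 2)).isPreconnected
    (fun y hy => (hder y hy).differentiableAt.differentiableWithinAt)
    (fun y hy => (hder y hy).deriv) (x := p) (y := 0) (by simpa using hp) (by simpa using hρ)
  have hQ0 : Q 0 = 1 := by
    rw [hQ]; simp only
    rw [tsum_eq_single 0 (fun n hn => by simp [hn])]
    simp [Qh_zero]
  have hV0 : V 0 = 0 := by
    rw [hV]; simp only
    rw [tsum_eq_single 0 (fun n hn => by simp [hn])]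
    simp [vv]
  simp only [hQ0, hV0, Complex.exp_zero, mul_one] at hconst
  rw [Complex.exp_neg]
  exact eq_inv_of_mul_eq_one_left hconst
end

section
open scoped Real
open Filter Topology PowerSeries

lemma ftNS_two (z : ℂ) : ftNS (2 * z) = tF z := by
  rw [ftNS, tF, mul_div_cancel_left₀ _ (two_ne_zero)]

lemma ftNS_half (z : ℂ) : ftNS z = tF (z / 2) := by
  rw [← ftNS_two]; congr 1; ring

lemma fR_eq (z : ℂ) : fR z = 4096 * sF z + 24 := by
  rw [fR, sF]; norm_num; ring

lemma summ_of {β : ℕ → ℂ} (h : ∀ z : ℂ, 0 < z.im → Summable fun n => β n * ee z ^ n) (r : ℝ) (h0 : 0 ≤ r)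
    (h1 : r < 1) : Summable fun n => ‖β n‖ * r ^ n := by
  rcases h0.eq_or_lt with rfl | h0
  · apply summable_of_ne_finset_zero (s := {0})
    intro b hb
    simp at hb
    simp [hb]
  · have hr : ‖(r : ℂ)‖ = r := by simp [abs_of_pos h0]
    obtain ⟨z, hz, he⟩ := ee_surj (q := (r : ℂ)) (by exact_mod_cast h0.ne') (by rw [hr]; exact h1)
    refine (h z hz).norm.congr fun n => ?_
    rw [norm_mul, norm_pow, he, hr]

lemma coef_unique {β : ℕ → ℂ} (h : ∀ z : ℂ, 0 < z.im → HasSum (fun n => β n * ee z ^ n) 0) (n : ℕ) : β n = 0 := by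
  have hs := summ_of fun z hz => (h z hz).summable
  have := coef_cauchy hs (r := 1 / 2) (M := 0) (by norm_num) (by norm_num) (fun q hq => by
    obtain ⟨z, hz, rfl⟩ := ee_surj (q := q) (by rintro rfl; simp at hq) (by rw [hq]; norm_num)
    have := (h z hz).tsum_eq
    simp [gT, this]) n
  simpa using this

lemma exp_ee (z : ℂ) (m : ℤ) : Complex.exp (Real.pi * Complex.I * (2 * z) * m) = ee z ^ m := by
  rw [ee_zpow, ee]; congr 1; ring

section
variable {c : ZMod 2 → ZMod 2 → ℤ → ℤ}
    (hexp : ∀ (i j : ZMod 2) (τ : ℂ), 0 < τ.im →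
      HasSum (fun m : ℤ => (c i j m : ℂ) * Complex.exp (Real.pi * Complex.I * τ * m))
        (Fcomp i j τ))
    (h00supp : ∀ m : ℤ, m < 0 ∨ ¬ (2 ∣ m) → c 0 0 m = 0)
    (h01supp : ∀ m : ℤ, m < 0 ∨ ¬ (2 ∣ m) → c 0 1 m = 0)
    (h10 : ∀ m : ℤ, c 1 0 m = - c 0 0 m)
    (h11supp : ∀ m : ℤ, m < -1 ∨ 2 ∣ m → c 1 1 m = 0)
    (h11pol : c 1 1 (-1) = 1)

noncomputable def al (c : ZMod 2 → ZMod 2 → ℤ → ℤ) (n : ℕ) : ℂ := ((c 1 1 n - c 0 0 n : ℤ) : ℂ)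

include hexp h00supp h11supp h11pol in
lemma al_sum {z : ℂ} (hz : 0 < z.im) :
    HasSum (fun n => al c n * ee z ^ n) (tF z - ee (-z)) := by
  have h1 := (hexp 1 1 (2 * z) (im_two hz)).sub (hexp 0 0 (2 * z) (im_two hz))
  have e : Fcomp 1 1 (2 * z) - Fcomp 0 0 (2 * z) = tF z := by
    rw [← ftNS_two]; simp [Fcomp]; ring
  rw [e] at h1
  have e2 : (fun m : ℤ => (c 1 1 m : ℂ) * Complex.exp (Real.pi * Complex.I * (2 * z) * m) -
      (c 0 0 m : ℂ) * Complex.exp (Real.pi * Complex.I * (2 * z) * m)) =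
      fun m : ℤ => ((c 1 1 m - c 0 0 m : ℤ) : ℂ) * ee z ^ m := by
    ext m; rw [exp_ee]; push_cast; ring
  rw [e2] at h1
  have hinj : Function.Injective (fun n : ℕ => (n : ℤ) - 1) := fun a b h => by simpa using h
  rw [← hinj.hasSum_iff] at h1
  · rw [← hasSum_nat_add_iff' 1] at h1
    have v1 : (fun n => ((fun m : ℤ => ((c 1 1 m - c 0 0 m : ℤ) : ℂ) * ee z ^ m) ∘ fun n : ℕ => (n : ℤ) - 1) (n + 1)) =
        fun n => al c n * ee z ^ n := by
      ext n
      simp only [Function.comp, al]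
      have : ((n + 1 : ℕ) : ℤ) - 1 = n := by push_cast; ring
      rw [this, zpow_natCast]
    have v2 : ∑ i ∈ Finset.range 1, ((fun m : ℤ => ((c 1 1 m - c 0 0 m : ℤ) : ℂ) * ee z ^ m) ∘ fun n : ℕ => (n : ℤ) - 1) i = ee (-z) := by
      simp [h11pol, h00supp (-1) (Or.inl (by norm_num)), ee_neg]
    rw [v1, v2] at h1
    exact h1
  · intro m hm
    have : m < -1 := by
      by_contra hc
      exact hm ⟨(m + 1).toNat, by simp only; omega⟩
    rw [h11supp m (Or.inl this), h00supp m (Or.inl (by omega))]; simp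

include hexp h00supp h11supp h11pol in
lemma al_isCoef : IsCoef (al c) := by
  have hs := summ_of fun z hz => (al_sum hexp h00supp h11supp h11pol hz).summable
  refine ⟨?_, hs, fun z hz => ?_⟩
  · have h1 := (hgT_lim hs 1).const_add (al c 0)
    rw [add_zero] at h1
    refine tendsto_nhds_unique (h1.congr' ?_) tF_lim
    filter_upwards [cuspF_pos 0] with z hz
    rw [← (al_sum hexp h00supp h11supp h11pol hz).tsum_eq]
    have := gT_succ hs (ee_norm_lt hz) 0
    rw [zero_add] at this
    rw [← this]; simp [gT]
  · rw [(al_sum hexp h00supp h11supp h11pol hz).tsum_eq]; ring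

include hexp h00supp h11supp h11pol h01supp in
lemma c01_eq {n : ℕ} (hn : n ≠ 0) : (c 0 1 (2 * n) : ℂ) = al c (2 * n) := by
  have hα := al_isCoef hexp h00supp h11supp h11pol
  have key : ∀ z : ℂ, 0 < z.im → HasSum (fun n : ℕ => ((c 0 1 (2 * n) : ℂ) - al c (2 * n) + if n = 0 then 24 else 0) * ee z ^ n) 0 := by
    intro z hz
    have h1 := hexp 0 1 z hz
    have hinj : Function.Injective (fun n : ℕ => 2 * (n : ℤ)) := fun a b h => by simpa using h
    rw [← hinj.hasSum_iff] at h1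
    · have hL := Lsum hα (d := 2) (by norm_num) hz
      rw [Finset.sum_range_succ, Finset.sum_range_one] at hL
      simp only [Nat.cast_zero, add_zero, Nat.cast_one, Nat.cast_ofNat] at hL
      rw [if_neg (by norm_num), zero_add] at hL
      have hU := U2 hz
      have hs2 : Summable fun r => al c (2 * r) * ee z ^ r := by
        have := (gT_summ' hα.summ (ee_norm_lt (im_half hz)) 0).of_norm
        simp only [zero_add] at this
        have h3 := this.comp_injective (i := fun r : ℕ => 2 * r) (fun a b h => by simpa using h)
        refine h3.congr fun r => ?_
        simp only [Function.comp]
        rw [ee_pow, ee_pow]; congr 2; push_cast; ring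
      have h4 := (h1.sub hs2.hasSum).add (hasSum_ite_eq (0:ℕ) (24:ℂ))
      have e : Fcomp 0 1 z - ∑' r, al c (2 * r) * ee z ^ r + 24 = 0 := by
        have : Fcomp 0 1 z = -(fR z + 24) / 2 := by simp [Fcomp]
        rw [this, fR_eq]
        linear_combination (-1/2 : ℂ) * hU + (1 / 2) * hL
      rw [e] at h4
      have v1 : (fun n : ℕ => ((c 0 1 (2 * n) : ℂ) - al c (2 * n) + if n = 0 then 24 else 0) * ee z ^ n) =
          fun n : ℕ => ((fun m : ℤ => (c 0 1 m : ℂ) * Complex.exp (Real.pi * Complex.I * z * m)) ∘ fun n : ℕ => 2 * (n : ℤ)) n -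
            al c (2 * n) * ee z ^ n + if n = 0 then 24 else 0 := by
        ext n
        simp only [Function.comp]
        have : Complex.exp (Real.pi * Complex.I * z * ((2 * (n : ℤ) : ℤ) : ℂ)) = ee z ^ n := by
          rw [ee_pow, ee]; congr 1; push_cast; ring
        rw [this]
        split_ifs with h
        · subst h; simp
        · ring
      rw [v1]
      exact h4
    · intro m hm
      have : m < 0 ∨ ¬ (2 ∣ m) := by
        by_contra hc
        push Not at hc
        exact hm ⟨(m / 2).toNat, by simp only; omega⟩
      rw [h01supp m this]; simp
  have := coef_unique key n
  rw [if_neg hn, add_zero] at this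
  exact sub_eq_zero.1 this

include hexp h00supp h11supp h11pol h01supp h10 in
lemma cc_nat {d : ℕ} (hd : 0 < d) (n : ℕ) : (c (d : ZMod 2) ((n : ℤ) : ZMod 2) (n * d) : ℂ) = bt (al c) d n := by
  have hα := al_isCoef hexp h00supp h11supp h11pol
  have e1 : ((n : ℤ) * (d : ℤ)) = ((d * n : ℕ) : ℤ) := by push_cast; ring
  rw [e1, Int.cast_natCast, bt]
  rcases Nat.even_or_odd' d with ⟨k, rfl | rfl⟩ <;> rcases Nat.even_or_odd' n with ⟨l, rfl | rfl⟩
  · have z1 : ((2 * k : ℕ) : ZMod 2) = 0 := by rw [ZMod.natCast_eq_zero_iff]; exact ⟨k, rfl⟩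
    have z2 : ((2 * l : ℕ) : ZMod 2) = 0 := by rw [ZMod.natCast_eq_zero_iff]; exact ⟨l, rfl⟩
    rw [z1, z2, if_pos ⟨⟨k, rfl⟩, ⟨l, rfl⟩⟩, al, h11supp _ (Or.inr ⟨k * (2 * l), by push_cast; ring⟩)]
    push_cast; ring
  · have z1 : ((2 * k : ℕ) : ZMod 2) = 0 := by rw [ZMod.natCast_eq_zero_iff]; exact ⟨k, rfl⟩
    have z2 : ((2 * l + 1 : ℕ) : ZMod 2) = 1 := by rw [Nat.cast_add, Nat.cast_mul]; simp; left; rfl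
    have e : 2 * k * (2 * l + 1) = 2 * (k * (2 * l + 1)) := by ring
    rw [z1, z2, if_neg (by omega), e, ← c01_eq hexp h00supp h01supp h11supp h11pol (by simp; omega)]
    push_cast; rfl
  · have z1 : ((2 * k + 1 : ℕ) : ZMod 2) = 1 := by rw [Nat.cast_add, Nat.cast_mul]; simp; left; rfl
    have z2 : ((2 * l : ℕ) : ZMod 2) = 0 := by rw [ZMod.natCast_eq_zero_iff]; exact ⟨l, rfl⟩
    rw [z1, z2, if_neg (by omega), al, h10, h11supp _ (Or.inr ⟨(2 * k + 1) * l, by push_cast; ring⟩)]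
    push_cast; ring
  · have z1 : ((2 * k + 1 : ℕ) : ZMod 2) = 1 := by rw [Nat.cast_add, Nat.cast_mul]; simp; left; rfl
    have z2 : ((2 * l + 1 : ℕ) : ZMod 2) = 1 := by rw [Nat.cast_add, Nat.cast_mul]; simp; left; rfl
    have e : (((2 * k + 1) * (2 * l + 1) : ℕ) : ℤ) = 2 * (2 * k * l + k + l : ℕ) + 1 := by push_cast; ring
    rw [z1, z2, if_neg (by omega), al, h00supp _ (Or.inr (by omega))]
    push_cast; ring

include h00supp h11supp h01supp h10 in
lemma cc_neg {d : ℕ} (hd : 0 < d) {r : ℤ} (hr : r < 0) (h : ¬ (d = 1 ∧ r = -1)) :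
    c (d : ZMod 2) (r : ZMod 2) (r * d) = 0 := by
  have hd' : (0 : ℤ) < d := by exact_mod_cast hd
  have hneg : r * d < 0 := mul_neg_of_neg_of_pos hr hd'
  have hcase : ∀ x : ZMod 2, x = 0 ∨ x = 1 := by decide
  rcases hcase d with z1 | z1 <;> rcases hcase r with z2 | z2 <;> rw [z1, z2]
  · exact h00supp _ (Or.inl hneg)
  · exact h01supp _ (Or.inl hneg)
  · rw [h10, h00supp _ (Or.inl hneg), neg_zero]
  · apply h11supp _ (Or.inl ?_)
    by_contra hc
    apply h
    have h1 : r * d = -1 := by omega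
    have h2 : (d : ℤ) = 1 := by nlinarith
    rw [h2] at h1
    exact ⟨by exact_mod_cast h2, by linarith⟩

end

lemma final_alg {α : ℕ → ℂ} (hα : IsCoef α) {σ z : ℂ} (hσ : 0 < σ.im) (hz : 0 < z.im)
    (hp : ‖ee σ‖ ≤ x0) (hh : ‖ee z‖ ≤ x0) :
    ee σ * (tF σ - tF z) = (1 - ee σ * (ee z)⁻¹) * ∑' n, coeff n (Qh α (ee z)) * ee σ ^ n := by
  have h0 := x0_pos
  have hs : Summable fun n => coeff n (Qh α (ee z)) * ee σ ^ n := by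
    refine (q_summ hα hh).of_norm_bounded fun n => ?_
    rw [norm_mul, norm_pow]; gcongr
  have hW := W_factor hα hz
  have hc : ∀ n, coeff (n + 1) (Qh α (ee z)) * ee σ ^ (n + 1) - ee σ * (ee z)⁻¹ * (coeff n (Qh α (ee z)) * ee σ ^ n) =
      ee σ * (α n * ee σ ^ n) - (if n = 0 then ee σ * tF z else 0) := by
    intro n
    have := congrArg (coeff (n + 1)) hW
    rw [sub_mul, one_mul, map_sub, mul_assoc, coeff_C_mul, coeff_succ_X_mul, Wx, coeff_mk] at this
    rcases n with _ | n
    · simp [hα.zero] at this ⊢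
      linear_combination (-ee σ) * this
    · simp at this ⊢
      linear_combination (-ee σ ^ (n + 2)) * this
  have hsα : Summable fun n => α n * ee σ ^ n := by
    simpa using (gT_summ' hα.summ (ee_norm_lt hσ) 0).of_norm
  have hs1 : Summable fun n => coeff (n + 1) (Qh α (ee z)) * ee σ ^ (n + 1) := (summable_nat_add_iff 1).2 hs
  have h1 : ∑' n, coeff n (Qh α (ee z)) * ee σ ^ n = 1 + ∑' n, coeff (n + 1) (Qh α (ee z)) * ee σ ^ (n + 1) := by
    rw [hs.tsum_eq_zero_add]; simp [Qh_zero]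
  have h2 := hs1.tsum_sub (hs.mul_left (ee σ * (ee z)⁻¹))
  rw [tsum_congr hc, Summable.tsum_sub (hsα.mul_left _) (hasSum_ite_eq (0:ℕ) _).summable, tsum_mul_left, tsum_mul_left, tsum_ite_eq] at h2
  rw [hα.eq σ hσ, ee_neg]
  have h3 := mul_inv_cancel₀ (ee_ne σ)
  linear_combination h3 + h2 - h1

lemma x0_im {z : ℂ} (hz : 5 < z.im) : ‖ee z‖ < x0 / 2 := by
  rw [ee_norm, x0]
  have h1 : Real.exp (-(2 * π * z.im)) ≤ Real.exp (-15 - 1) := by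
    rw [Real.exp_le_exp]; nlinarith [Real.pi_gt_three]
  refine h1.trans_lt ?_
  rw [Real.exp_sub]
  have := Real.exp_one_gt_d9
  gcongr
  linarith

theorem prod_nat {α : ℕ → ℂ} (hα : IsCoef α) {σ z : ℂ} (hσ : 0 < σ.im) (hz : 0 < z.im)
    (hp : ‖ee σ‖ < x0 / 2) (hh : ‖ee z‖ ≤ x0) {k : ℕ → ℕ → ℤ} (hk : ∀ d n, (k d n : ℂ) = bt α (d + 1) n) :
    HasProd (fun dn : ℕ × ℕ => (1 - ee σ ^ (dn.1 + 1) * ee z ^ dn.2) ^ k dn.1 dn.2)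
      (∑' n, coeff n (Qh α (ee z)) * ee σ ^ n) := by
  have h0 := x0_pos
  have hp' : ‖ee σ‖ ≤ x0 := by linarith
  rw [Q_exp hα hz hp hh, (V_sum hα hz hp' hh).tsum_eq]
  have h1 := log_sum hα hp' hh
  have hinj : Function.Injective (fun dn : ℕ × ℕ => (dn.1 + 1, dn.2)) := by
    rintro ⟨a, b⟩ ⟨c, d⟩ h
    simpa using h
  rw [← hinj.hasSum_iff] at h1
  · have h2 := h1.neg.cexp
    have e : (fun dn : ℕ × ℕ => (1 - ee σ ^ (dn.1 + 1) * ee z ^ dn.2) ^ k dn.1 dn.2) =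
        Complex.exp ∘ fun b => -((fun dr : ℕ × ℕ => -(bt α dr.1 dr.2 * Complex.log (1 - ee σ ^ dr.1 * ee z ^ dr.2))) ∘
          fun dn : ℕ × ℕ => (dn.1 + 1, dn.2)) b := by
      ext ⟨d, n⟩
      simp only [Function.comp, neg_neg]
      have hx : ‖ee σ ^ (d + 1) * ee z ^ n‖ < 1 := by
        rw [norm_mul, norm_pow, norm_pow]
        have h1 : ‖ee σ‖ ^ (d + 1) < 1 := pow_lt_one₀ (norm_nonneg _) (ee_norm_lt hσ) d.succ_ne_zero
        have h2 : ‖ee z‖ ^ n ≤ 1 := pow_le_one₀ (norm_nonneg _) (ee_norm_lt hz).le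
        exact mul_lt_one_of_nonneg_of_lt_one_left (by positivity) h1 h2
      have hne : 1 - ee σ ^ (d + 1) * ee z ^ n ≠ 0 := by
        intro h
        rw [← sub_eq_zero.1 h, norm_one] at hx
        exact lt_irrefl _ hx
      rw [← hk, Complex.exp_int_mul, Complex.exp_log hne]
    rw [e]
    exact h2
  · rintro ⟨d, n⟩ hd
    rcases d with _ | d
    · simp [bt_zero_left hα.zero]
    · exact absurd ⟨(d, n), rfl⟩ hd
end

/-- there is `Y > 0` such that for `Im σ, Im τ > Y` the product over
    `d ≥ 1`, `r ∈ ℤ` of `(1 − p^d q^{r/2})^{C_{d mod 2, r mod 2}(rd/2)}` converges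
    (absolutely, i.e. unconditionally) to `p · (f̃_NS(2σ) − f̃_NS(τ))`. -/
theorem statement2 (c : ZMod 2 → ZMod 2 → ℤ → ℤ)
    -- `c i j m` is the Fourier coefficient `C_{i,j}(m/2)`; expansions `F_{i,j}(τ) = ∑ C_{i,j}(n) qⁿ`
    (hexp : ∀ (i j : ZMod 2) (τ : ℂ), 0 < τ.im →
      HasSum (fun m : ℤ => (c i j m : ℂ) * Complex.exp (Real.pi * Complex.I * τ * m))
        (Fcomp i j τ))
    -- `C_{0,0}` and `C_{0,1}` are supported on nonnegative integers
    (h00supp : ∀ m : ℤ, m < 0 ∨ ¬ (2 ∣ m) → c 0 0 m = 0)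
    (h01supp : ∀ m : ℤ, m < 0 ∨ ¬ (2 ∣ m) → c 0 1 m = 0)
    -- `C_{1,0} = −C_{0,0}`
    (h10 : ∀ m : ℤ, c 1 0 m = - c 0 0 m)
    -- `C_{1,1}` is supported on half-odd-integers `n ≥ −1/2`, with `C_{1,1}(−1/2) = 1`
    (h11supp : ∀ m : ℤ, m < -1 ∨ 2 ∣ m → c 1 1 m = 0)
    (h11pol : c 1 1 (-1) = 1) :
    ∃ Y > (0 : ℝ), ∀ σ τ : ℂ, Y < σ.im → Y < τ.im →
      HasProd (fun dr : ℕ × ℤ =>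
        (1 - Complex.exp (2 * Real.pi * Complex.I * σ) ^ (dr.1 + 1) *
              Complex.exp (Real.pi * Complex.I * τ * dr.2)) ^
          c ((dr.1 + 1 : ℕ) : ZMod 2) ((dr.2 : ZMod 2)) (dr.2 * (dr.1 + 1)))
        (Complex.exp (2 * Real.pi * Complex.I * σ) * (ftNS (2 * σ) - ftNS τ)) := by
  refine ⟨10, by norm_num, fun σ τ hσ hτ => ?_⟩
  have hα := al_isCoef hexp h00supp h11supp h11pol
  have hz : 5 < (τ / 2).im := by
    have : (τ / 2).im = τ.im / 2 := by simp
    rw [this]; linarith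
  have hp := x0_im (z := σ) (by linarith)
  have hh := x0_im hz
  have h0 := x0_pos
  have hP := prod_nat hα (σ := σ) (z := τ / 2) (by linarith) (by linarith) hp (by linarith)
    (k := fun d n => c ((d + 1 : ℕ) : ZMod 2) ((n : ℤ) : ZMod 2) (n * (d + 1 : ℕ)))
    (fun d n => cc_nat hexp h00supp h01supp h10 h11supp h11pol d.succ_pos n)
  have hfin := final_alg hα (σ := σ) (z := τ / 2) (by linarith) (by linarith) (by linarith) (by linarith)
  have hee : Complex.exp (2 * Real.pi * Complex.I * σ) = ee σ := rfl
  have hee2 : ∀ r : ℤ, Complex.exp (Real.pi * Complex.I * τ * r) = ee (τ / 2) ^ r := by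
    intro r; rw [ee_zpow, ee]; congr 1; ring
  rw [ftNS_two, ftNS_half, hee, hfin]
  simp only [hee2]
  set P := ∑' n, PowerSeries.coeff n (Qh (al c) (ee (τ / 2))) * ee σ ^ n
  let g : ℕ × ℤ → ℂ := fun dr => if dr.2 < 0 then 1 else (1 - ee σ ^ (dr.1 + 1) * ee (τ / 2) ^ dr.2) ^
          c ((dr.1 + 1 : ℕ) : ZMod 2) ((dr.2 : ZMod 2)) (dr.2 * (dr.1 + 1))
  have hinj : Function.Injective (fun dn : ℕ × ℕ => (dn.1, (dn.2 : ℤ))) := by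
    rintro ⟨a, b⟩ ⟨c, d⟩ h
    simpa using h
  have hg : HasProd g P := by
    rw [← hinj.hasProd_iff]
    · have : (g ∘ fun dn : ℕ × ℕ => (dn.1, (dn.2 : ℤ))) = fun dn : ℕ × ℕ => (1 - ee σ ^ (dn.1 + 1) * ee (τ / 2) ^ dn.2) ^
          c ((dn.1 + 1 : ℕ) : ZMod 2) (((dn.2 : ℕ) : ℤ) : ZMod 2) (dn.2 * (dn.1 + 1 : ℕ)) := by
        ext dn
        simp only [Function.comp, g]
        rw [if_neg (by omega), zpow_natCast]
        push_cast; rfl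
      rw [this]; exact hP
    · rintro ⟨d, r⟩ hr
      have : r < 0 := by
        by_contra hc
        exact hr ⟨(d, r.toNat), by simp only [Prod.mk.injEq, true_and]; omega⟩
      simp only [g]; rw [if_pos this]
  have hfull := (hasProd_ite_eq ((0, -1) : ℕ × ℤ) (1 - ee σ * (ee (τ / 2))⁻¹)).mul hg
  have e : (fun dr : ℕ × ℤ => (1 - ee σ ^ (dr.1 + 1) * ee (τ / 2) ^ dr.2) ^
          c ((dr.1 + 1 : ℕ) : ZMod 2) ((dr.2 : ZMod 2)) (dr.2 * (dr.1 + 1))) =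
      fun dr : ℕ × ℤ => (if dr = (0, -1) then (1 - ee σ * (ee (τ / 2))⁻¹) else 1) * g dr := by
    ext ⟨d, r⟩
    simp only [g]
    by_cases hr : r < 0
    · rw [if_pos hr, mul_one]
      by_cases h : d + 1 = 1 ∧ r = -1
      · obtain ⟨h1, rfl⟩ := h
        obtain rfl : d = 0 := by omega
        have z2 : ((-1 : ℤ) : ZMod 2) = 1 := by decide
        simp only [z2]
        simp [h11pol]
      · have := cc_neg h00supp h01supp h10 h11supp d.succ_pos hr h
        push_cast at this ⊢
        rw [this, zpow_zero, if_neg]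
        simp only [Prod.mk.injEq]
        omega
    · rw [if_neg hr, if_neg, one_mul]
      simp only [Prod.mk.injEq]
      omega
  rw [e]
  exact hfull
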